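/- If K is a combinatorial category and C is a small category, then the functor category K^C, with the pointwise cofibration structure (a natural transformation f is a cofibration iff each component f_c is a cofibration in K), is a combinatorial category: K^C is locally presentable and the pointwise cofibrations are cofibrantly generated by a set of morphisms. -/

import Mathlib

open CategoryTheory Category Limits Opposite

universe w v u u' u''

namespace CellularPaper

variable {K : Type u} [Category.{v} K]

/-- The restriction of a chain `F : J ⥤ K` to the elements below `j`. -/
def restrictionLT {J : Type w} [Preorder J] (F : J ⥤ K) (j : J) :
    {i : J // i < j} ⥤ K :=
  (Monotone.functor (f := fun i : {i : J // i < j} => (i : J)) fun _ _ h => h) ⋙ F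

/-- The cocone on the restriction of `F` below `j` with apex `F.obj j`. -/
@[simps]
def coconeLT {J : Type w} [Preorder J] (F : J ⥤ K) (j : J) :
    Cocone (restrictionLT F j) where
  pt := F.obj j
  ι :=
    { app := fun i => F.map (homOfLE i.2.le)
      naturality := fun i i' h => by
        dsimp [restrictionLT, Monotone.functor]
        rw [← F.map_comp]
        simp }

/-- `f` is a transfinite composite of a smooth chain with links in `C`. -/
def IsTransfiniteCompositionOf (C : MorphismProperty K) : MorphismProperty K :=
  fun A B f =>
    ∃ (J : Type w) (_ : LinearOrder J) (_ : SuccOrder J) (_ : OrderBot J)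
      (_ : WellFoundedLT J) (F : J ⥤ K) (c : Cocone F) (_ : IsColimit c)
      (eA : A ≅ F.obj ⊥) (eB : c.pt ≅ B),
      (∀ j : J, ¬IsMax j → C (F.map (homOfLE (Order.le_succ j)))) ∧
      (∀ j : J, Order.IsSuccLimit j → Nonempty (IsColimit (coconeLT F j))) ∧
      eA.hom ≫ c.ι.app ⊥ ≫ eB.hom = f

/-- A cellular structure: a class of morphisms containing all isomorphisms and closed
under pushout and transfinite composition. -/
structure IsCellular (C : MorphismProperty K) : Prop where
  isos : ∀ {A B : K} (f : A ⟶ B), IsIso f → C f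
  pushout : ∀ {A B A' B' : K} {f : A ⟶ B} {u : A ⟶ A'} {v : B ⟶ B'} {g : A' ⟶ B'},
    IsPushout f u v g → C f → C g
  transfinite : ∀ {A B : K} (f : A ⟶ B), IsTransfiniteCompositionOf.{v} C f → C f

/-- `f` is a retract of `g` in the arrow category. -/
def IsRetractOf {A B X Y : K} (f : A ⟶ B) (g : X ⟶ Y) : Prop :=
  ∃ (u : A ⟶ X) (v : B ⟶ Y) (r : X ⟶ A) (s : Y ⟶ B),
    u ≫ g = f ≫ v ∧ r ≫ f = g ≫ s ∧ u ≫ r = 𝟙 A ∧ v ≫ s = 𝟙 B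

/-- The class of retracts of morphisms in `C`. -/
def retracts (C : MorphismProperty K) : MorphismProperty K :=
  fun _ _ f => ∃ (X Y : K) (g : X ⟶ Y), C g ∧ IsRetractOf f g

/-- The class of pushouts of morphisms in `C`. -/
def Po (C : MorphismProperty K) : MorphismProperty K :=
  fun A' B' g => ∃ (A B : K) (f : A ⟶ B) (u : A ⟶ A') (v : B ⟶ B'),
    C f ∧ IsPushout f u v g

/-- A κ-directed preorder. -/
def IsCardinalDirected (P : Type v) [Preorder P] (κ : Cardinal.{v}) : Prop :=
  ∀ S : Set P, Cardinal.mk S < κ → ∃ p : P, ∀ s ∈ S, s ≤ p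

/-- A κ-presentable object: its hom-functor preserves κ-directed colimits. -/
def IsCardinalPresentable (κ : Cardinal.{v}) (A : K) : Prop :=
  ∀ (P : Type v) (_ : Preorder P), IsCardinalDirected P κ →
    Nonempty (PreservesColimitsOfShape P (coyoneda.obj (op A)))

/-- A locally κ-presentable category. -/
structure IsLocallyPresentable (κ : Cardinal.{v}) (K : Type u) [Category.{v} K] : Prop where
  regular : κ.IsRegular
  hasColimits : HasColimits K
  generators : ∃ (ι : Type v) (G : ι → K), (∀ i, IsCardinalPresentable κ (G i)) ∧
    ∀ X : K, ∃ (P : Type v) (_ : Preorder P) (F : P ⥤ K) (c : Cocone F) (_ : IsColimit c),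
      IsCardinalDirected P κ ∧ Nonempty (c.pt ≅ X) ∧ ∀ p : P, ∃ i, Nonempty (F.obj p ≅ G i)

/-- A locally presentable category. -/
def LocallyPresentable (K : Type u) [Category.{v} K] : Prop :=
  ∃ κ : Cardinal.{v}, IsLocallyPresentable κ K

/-- The smallest cellular class containing `X`. -/
def cellClosure (X : MorphismProperty K) : MorphismProperty K :=
  fun _ _ f => ∀ C : MorphismProperty K, IsCellular C → X ≤ C → C f

/-- `cof(X)`: retracts of transfinite composites of pushouts of `X`. -/
def cofClosure (X : MorphismProperty K) : MorphismProperty K :=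
  retracts (IsTransfiniteCompositionOf.{v} (Po X))

/-- The morphism property generated by a family of morphisms. -/
def ofFamily {ι : Type*} {a b : ι → K} (s : ∀ i, a i ⟶ b i) : MorphismProperty K :=
  fun _ _ f => ∃ i, Nonempty (Arrow.mk f ≅ Arrow.mk (s i))

/-- `C` is cofibrantly generated by a set of morphisms. -/
def IsCofibrantlyGenerated (C : MorphismProperty K) : Prop :=
  ∃ (ι : Type v) (a b : ι → K) (s : ∀ i, a i ⟶ b i),
    C = cofClosure (ofFamily s)

/-- A combinatorial structure on a locally presentable category. -/
structure IsCombinatorial (K : Type u) [Category.{v} K] (C : MorphismProperty K) : Prop where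
  locallyPresentable : LocallyPresentable K
  cellular : IsCellular C
  retractClosed : retracts C ≤ C
  cofibrantlyGenerated : IsCofibrantlyGenerated C

/-- `f` is a transfinite composite of length `< κ` of morphisms in `C`. -/
def IsBoundedTransfiniteCompositionOf (κ : Cardinal.{v}) (C : MorphismProperty K) :
    MorphismProperty K :=
  fun A B f =>
    ∃ (J : Type v) (_ : LinearOrder J) (_ : SuccOrder J) (_ : OrderBot J)
      (_ : WellFoundedLT J), Cardinal.mk J < κ ∧
      ∃ (F : J ⥤ K) (c : Cocone F) (_ : IsColimit c)
        (eA : A ≅ F.obj ⊥) (eB : c.pt ≅ B),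
        (∀ j : J, ¬IsMax j → C (F.map (homOfLE (Order.le_succ j)))) ∧
        (∀ j : J, Order.IsSuccLimit j → Nonempty (IsColimit (coconeLT F j))) ∧
        eA.hom ≫ c.ι.app ⊥ ≫ eB.hom = f

/-- The morphisms of `C` with κ-presentable domain and codomain. -/
def betweenPresentable (κ : Cardinal.{v}) (C : MorphismProperty K) : MorphismProperty K :=
  fun A B f => C f ∧ IsCardinalPresentable κ A ∧ IsCardinalPresentable κ B

/-- `Po_κ(X)`: pushouts of morphisms of `X` between κ-presentable objects. -/
def PoCard (κ : Cardinal.{v}) (X : MorphismProperty K) : MorphismProperty K :=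
  betweenPresentable κ (Po X)

/-- The category `psh(K²)`: objects are morphisms of `K`, morphisms are pushout squares. -/
structure PshArrow (K : Type u) [Category.{v} K] : Type max u v where
  arr : Arrow K

instance : Category.{v} (PshArrow K) where
  Hom g f := {φ : g.arr ⟶ f.arr // IsPushout g.arr.hom φ.left φ.right f.arr.hom}
  id g := ⟨𝟙 _, IsPushout.of_vert_isIso ⟨by simp⟩⟩
  comp φ ψ := ⟨φ.1 ≫ ψ.1, φ.2.paste_vert ψ.2⟩
  id_comp φ := Subtype.ext (Category.id_comp _)
  comp_id φ := Subtype.ext (Category.comp_id _)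
  assoc _ _ _ := Subtype.ext (Category.assoc _ _ _)


section PsPull

variable {K : Type u} {L : Type u'} {M : Type u''}
variable [Category.{v} K] [Category.{v} L] [Category.{v} M]

/-- The pseudopullback of `F : K ⥤ M` and `G : L ⥤ M`. -/
structure PsPull (F : K ⥤ M) (G : L ⥤ M) : Type max u u' v where
  k : K
  l : L
  t : F.obj k ≅ G.obj l

variable {F : K ⥤ M} {G : L ⥤ M}

/-- Morphisms in the pseudopullback. -/
@[ext]
structure PsHom (a b : PsPull F G) : Type v where
  hk : a.k ⟶ b.k
  hl : a.l ⟶ b.l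
  w : F.map hk ≫ b.t.hom = a.t.hom ≫ G.map hl

instance : Category.{v} (PsPull F G) where
  Hom := PsHom
  id a := ⟨𝟙 _, 𝟙 _, by simp⟩
  comp f g := ⟨f.hk ≫ g.hk, f.hl ≫ g.hl, by
    rw [F.map_comp, G.map_comp, Category.assoc, g.w, ← Category.assoc, f.w,
      Category.assoc]⟩

/-- The first projection of the pseudopullback. -/
def projK (F : K ⥤ M) (G : L ⥤ M) : PsPull F G ⥤ K where
  obj a := a.k
  map f := f.hk

/-- The second projection of the pseudopullback. -/
def projL (F : K ⥤ M) (G : L ⥤ M) : PsPull F G ⥤ L where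
  obj a := a.l
  map f := f.hl

/-- `Ps(C, D)`: morphisms of the pseudopullback whose projections lie in `C` and `D`. -/
def PsClass (C : MorphismProperty K) (D : MorphismProperty L) :
    MorphismProperty (PsPull F G) :=
  fun _ _ f => C f.hk ∧ D f.hl

end PsPull

section CellSystems

variable {Λ : Type v} {a b : Λ → K}

/-- The data needed to attach a cell with boundary `A` to a complex with cells `b`: the set `U`
of cells below, an object `L` receiving these cells, and the attaching map `φ`. -/
structure Attach (b : Λ → K) (A : K) where
  U : Set Λ
  L : K
  x : ∀ q ∈ U, (b q ⟶ L)
  φ : A ⟶ L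

/-- A family of maps out of the cells in `S` which is compatible with the attaching maps. -/
def IsSol (s : ∀ c, a c ⟶ b c) (att : ∀ c, Attach b (a c)) (S : Set Λ) {W : K}
    (y : ∀ q ∈ S, (b q ⟶ W)) : Prop :=
  ∀ (c : Λ) (hc : c ∈ S), ∃ (hU : ∀ q ∈ (att c).U, q ∈ S) (l : (att c).L ⟶ W),
    (∀ q hq, (att c).x q hq ≫ l = y q (hU q hq)) ∧ s c ≫ y c hc = (att c).φ ≫ l

/-- `T` corepresents the compatible families on `S`. -/
structure IsCorep (s : ∀ c, a c ⟶ b c) (att : ∀ c, Attach b (a c)) (S : Set Λ) (T : K)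
    (x : ∀ q ∈ S, (b q ⟶ T)) : Prop where
  sol : IsSol s att S x
  exists_desc : ∀ {W : K} (y : ∀ q ∈ S, (b q ⟶ W)), IsSol s att S y →
    ∃ l : T ⟶ W, ∀ q hq, x q hq ≫ l = y q hq
  hom_ext : ∀ {W : K} (l₁ l₂ : T ⟶ W), (∀ q hq, x q hq ≫ l₁ = x q hq ≫ l₂) → l₁ = l₂

/-- The attaching object of `c` corepresents the compatible families on the cells below `c`. -/
def IsValidAt (s : ∀ c, a c ⟶ b c) (att : ∀ c, Attach b (a c)) (c : Λ) : Prop :=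
  IsCorep s att (att c).U (att c).L (att c).x

/-- `S` contains the cells below each of its elements. -/
def IsClosedUnder (att : ∀ c, Attach b (a c)) (S : Set Λ) : Prop :=
  ∀ c ∈ S, ∀ q ∈ (att c).U, q ∈ S

variable {s : ∀ c, a c ⟶ b c} {att : ∀ c, Attach b (a c)}

lemma IsSol.isClosedUnder {S : Set Λ} {W : K} {y : ∀ q ∈ S, (b q ⟶ W)} (h : IsSol s att S y) :
    IsClosedUnder att S := fun c hc => (h c hc).1

lemma IsSol.comp {S : Set Λ} {W W' : K} {y : ∀ q ∈ S, (b q ⟶ W)} (h : IsSol s att S y)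
    (g : W ⟶ W') : IsSol s att S fun q hq => y q hq ≫ g := by
  intro c hc
  obtain ⟨hU, l, h₁, h₂⟩ := h c hc
  exact ⟨hU, l ≫ g, fun q hq => ((assoc _ _ _).symm.trans (congrArg (· ≫ g) (h₁ q hq))),
    by rw [← assoc, h₂, assoc]⟩

lemma IsSol.restrict {S S' : Set Λ} {W : K} {y : ∀ q ∈ S, (b q ⟶ W)} (h : IsSol s att S y)
    (hS : ∀ q ∈ S', q ∈ S) (hS' : IsClosedUnder att S') :
    IsSol s att S' fun q hq => y q (hS q hq) := by
  intro c hc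
  obtain ⟨hU, l, h₁, h₂⟩ := h c (hS c hc)
  exact ⟨hS' c hc, l, fun q hq => h₁ q hq, h₂⟩

lemma isSol_of_cover {S : Set Λ} {W : K} {y : ∀ q ∈ S, (b q ⟶ W)}
    (h : ∀ c ∈ S, ∃ (S' : Set Λ) (hS : ∀ q ∈ S', q ∈ S), c ∈ S' ∧
      IsSol s att S' fun q hq => y q (hS q hq)) :
    IsSol s att S y := by
  intro c hc
  obtain ⟨S', hS, hc', h'⟩ := h c hc
  obtain ⟨hU, l, h₁, h₂⟩ := h' c hc'
  exact ⟨fun q hq => hS q (hU q hq), l, h₁, h₂⟩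

lemma IsSol.congr_att {att' : ∀ c, Attach b (a c)} {S : Set Λ} (hatt : ∀ c ∈ S, att c = att' c)
    {W : K} {y : ∀ q ∈ S, (b q ⟶ W)} (h : IsSol s att S y) : IsSol s att' S y := by
  intro c hc
  rw [← hatt c hc]
  exact h c hc

lemma IsCorep.congr_att {att' : ∀ c, Attach b (a c)} {S : Set Λ} (hatt : ∀ c ∈ S, att c = att' c)
    {T : K} {x : ∀ q ∈ S, (b q ⟶ T)} (h : IsCorep s att S T x) : IsCorep s att' S T x where
  sol := h.sol.congr_att hatt
  exists_desc y hy := h.exists_desc y (hy.congr_att fun c hc => (hatt c hc).symm)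
  hom_ext := h.hom_ext

section Existence

variable (s att) (S : Set Λ)

/-- The generators of the colimit attached to `S`. -/
noncomputable abbrev generatorObj [HasColimits K] : K :=
  (∐ fun c : S => b c) ⨿ (∐ fun c : S => (att c).L)

/-- The relations of the colimit attached to `S`. -/
noncomputable abbrev relationObj [HasColimits K] : K :=
  (∐ fun q : Σ c : S, (att c).U => b q.2) ⨿ (∐ fun c : S => a c)

variable [HasColimits K] (hS : IsClosedUnder att S)

/-- The inclusion of a generator of the first kind. -/
noncomputable def generatorInl (q : Λ) (hq : q ∈ S) : b q ⟶ generatorObj att S :=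
  Sigma.ι (fun c : S => b c) ⟨q, hq⟩ ≫ coprod.inl

/-- The inclusion of a generator of the second kind. -/
noncomputable def generatorInr (c : Λ) (hc : c ∈ S) : (att c).L ⟶ generatorObj att S :=
  Sigma.ι (fun c : S => (att c).L) ⟨c, hc⟩ ≫ coprod.inr

/-- The first of the maps from relations to generators. -/
noncomputable def relationFst : relationObj att S ⟶ generatorObj att S :=
  coprod.desc (Sigma.desc fun q => generatorInl att S q.2.1 (hS _ q.1.2 _ q.2.2))
    (Sigma.desc fun c => s c ≫ generatorInl att S c.1 c.2)

/-- The second of the maps from relations to generators. -/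
noncomputable def relationSnd : relationObj att S ⟶ generatorObj att S :=
  coprod.desc (Sigma.desc fun q => (att q.1).x q.2.1 q.2.2 ≫ generatorInr att S q.1 q.1.2)
    (Sigma.desc fun c => (att c).φ ≫ generatorInr att S c.1 c.2)

lemma relation_comp_eq_iff {W : K} (g : generatorObj att S ⟶ W) :
    relationFst s att S hS ≫ g = relationSnd att S ≫ g ↔
      (∀ c (hc : c ∈ S) q (hq : q ∈ (att c).U), generatorInl att S q (hS c hc q hq) ≫ g =
        (att c).x q hq ≫ generatorInr att S c hc ≫ g) ∧
      ∀ c (hc : c ∈ S), s c ≫ generatorInl att S c hc ≫ g =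
        (att c).φ ≫ generatorInr att S c hc ≫ g := by
  constructor
  · intro h
    constructor
    · intro c hc q hq
      have := (Sigma.ι (fun q : Σ c : S, (att c).U => b q.2) ⟨⟨c, hc⟩, ⟨q, hq⟩⟩ ≫ coprod.inl) ≫= h
      simpa [relationFst, relationSnd, coprod.inl_desc_assoc, coprod.inr_desc_assoc,
        -coprod.desc_comp] using this
    · intro c hc
      have := (Sigma.ι (fun c : S => a c) ⟨c, hc⟩ ≫ coprod.inr) ≫= h
      simpa [relationFst, relationSnd, coprod.inl_desc_assoc, coprod.inr_desc_assoc,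
        -coprod.desc_comp] using this
  · rintro ⟨h₁, h₂⟩
    refine coprod.hom_ext (Sigma.hom_ext _ _ fun ⟨c, q⟩ => ?_) (Sigma.hom_ext _ _ fun c => ?_)
    · simpa [relationFst, relationSnd, coprod.inl_desc_assoc, coprod.inr_desc_assoc,
        -coprod.desc_comp] using h₁ c.1 c.2 q.1 q.2
    · simpa [relationFst, relationSnd, coprod.inl_desc_assoc, coprod.inr_desc_assoc,
        -coprod.desc_comp] using h₂ c.1 c.2

/-- An object corepresenting the compatible families on `S`. -/
noncomputable abbrev corepObj : K := coequalizer (relationFst s att S hS) (relationSnd att S)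

/-- The projection from the generators. -/
noncomputable def corepπ : generatorObj att S ⟶ corepObj s att S hS := coequalizer.π _ _

lemma isCorep_corepObj (hv : ∀ c ∈ S, IsValidAt s att c) :
    IsCorep s att S (corepObj s att S hS)
      (fun q hq => generatorInl att S q hq ≫ corepπ s att S hS) := by
  have hπ := (relation_comp_eq_iff s att S hS (corepπ s att S hS)).1 (coequalizer.condition _ _)
  refine ⟨fun c hc => ⟨hS c hc, generatorInr att S c hc ≫ corepπ s att S hS,
    fun q hq => (hπ.1 c hc q hq).symm, hπ.2 c hc⟩, fun {W} y hy => ?_, fun {W} l l' h => ?_⟩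
  · choose hU l h₁ h₂ using hy
    let g : generatorObj att S ⟶ W :=
      coprod.desc (Sigma.desc fun c => y c.1 c.2) (Sigma.desc fun c => l c.1 c.2)
    have hg₁ : ∀ q hq, generatorInl att S q hq ≫ g = y q hq := by
      simp [generatorInl, g, coprod.inl_desc]
    have hg₂ : ∀ q hq, generatorInr att S q hq ≫ g = l q hq := by
      simp [generatorInr, g, coprod.inr_desc]
    have hg := (relation_comp_eq_iff s att S hS g).2
      ⟨fun c hc q hq => by rw [hg₁, hg₂, h₁], fun c hc => by rw [hg₁, hg₂, h₂]⟩
    refine ⟨coequalizer.desc g hg, fun q hq => ?_⟩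
    rw [assoc, corepπ, coequalizer.π_desc, hg₁]
  · refine coequalizer.hom_ext (coprod.hom_ext (Sigma.hom_ext _ _ fun c => ?_)
      (Sigma.hom_ext _ _ fun c => ?_))
    · simpa only [generatorInl, corepπ, assoc] using h c.1 c.2
    · have : generatorInr att S c.1 c.2 ≫ corepπ s att S hS ≫ l =
          generatorInr att S c.1 c.2 ≫ corepπ s att S hS ≫ l' := by
        refine (hv c.1 c.2).hom_ext _ _ fun q hq => ?_
        have := h q (hS c.1 c.2 q hq)
        simp only [assoc] at this
        simpa only [← assoc, ← hπ.1 c.1 c.2 q hq] using this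
      simpa only [generatorInr, corepπ, assoc] using this

end Existence

end CellSystems

section CellSystems

variable {Λ : Type v} {a b : Λ → K} {s : ∀ c, a c ⟶ b c} {att : ∀ c, Attach b (a c)}

section Functoriality

variable {S S' S'' : Set Λ} {T T' T'' : K} {x'' : ∀ q ∈ S'', (b q ⟶ T'')}
  {x' : ∀ q ∈ S', (b q ⟶ T')} {x : ∀ q ∈ S, (b q ⟶ T)}

/-- The map between corepresenting objects induced by an inclusion. -/
noncomputable def IsCorep.map (h : IsCorep s att S T x) (h' : IsCorep s att S' T' x')
    (hS : ∀ q ∈ S, q ∈ S') : T ⟶ T' :=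
  (h.exists_desc _ (h'.sol.restrict hS h.sol.isClosedUnder)).choose

lemma IsCorep.fac_map (h : IsCorep s att S T x) (h' : IsCorep s att S' T' x')
    (hS : ∀ q ∈ S, q ∈ S') (q : Λ) (hq : q ∈ S) : x q hq ≫ h.map h' hS = x' q (hS q hq) :=
  (h.exists_desc _ (h'.sol.restrict hS h.sol.isClosedUnder)).choose_spec q hq

lemma IsCorep.fac_map_assoc (h : IsCorep s att S T x) (h' : IsCorep s att S' T' x')
    (hS : ∀ q ∈ S, q ∈ S') (q : Λ) (hq : q ∈ S) {W : K} (g : T' ⟶ W) :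
    x q hq ≫ h.map h' hS ≫ g = x' q (hS q hq) ≫ g := by
  rw [← assoc, h.fac_map]

lemma IsCorep.map_self (h : IsCorep s att S T x) : h.map h (fun _ => id) = 𝟙 T :=
  h.hom_ext _ _ fun q hq => by rw [h.fac_map, comp_id]

lemma IsCorep.map_map (h : IsCorep s att S T x) (h' : IsCorep s att S' T' x')
    (h'' : IsCorep s att S'' T'' x'') (hS : ∀ q ∈ S, q ∈ S') (hS' : ∀ q ∈ S', q ∈ S'') :
    h.map h' hS ≫ h'.map h'' hS' = h.map h'' (fun q hq => hS' q (hS q hq)) :=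
  h.hom_ext _ _ fun q hq => by rw [h.fac_map_assoc, h'.fac_map, h.fac_map]

variable {P : Type*} (R : P → Set Λ)
  {F : P → K} {y : ∀ p, ∀ q ∈ R p, (b q ⟶ F p)} (h : ∀ p, IsCorep s att (R p) (F p) (y p))

lemma exists_desc_of_cover (hT : IsCorep s att S T x) (hS : ∀ p, ∀ q ∈ R p, q ∈ S)
    (hR' : ∀ q ∈ S, ∃ p, q ∈ R p) {W : K} (f : ∀ p, F p ⟶ W)
    (hf : ∀ p p' q (hq : q ∈ R p) (hq' : q ∈ R p'), y p q hq ≫ f p = y p' q hq' ≫ f p') :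
    ∃ l : T ⟶ W, ∀ p, (h p).map hT (hS p) ≫ l = f p := by
  choose p hp using hR'
  obtain ⟨l, hl⟩ := hT.exists_desc (fun q hq => y (p q hq) q (hp q hq) ≫ f (p q hq)) (by
    refine isSol_of_cover fun c hc => ⟨R (p c hc), hS _, hp c hc, ?_⟩
    convert! (h (p c hc)).sol.comp (f (p c hc)) using 3
    exact hf _ _ _ _ _)
  refine ⟨l, fun p' => (h p').hom_ext _ _ fun q hq => ?_⟩
  rw [(h p').fac_map_assoc, hl]
  exact hf _ _ _ _ _

lemma hom_ext_of_cover (hT : IsCorep s att S T x) (hS : ∀ p, ∀ q ∈ R p, q ∈ S)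
    (hR' : ∀ q ∈ S, ∃ p, q ∈ R p) {W : K} (l l' : T ⟶ W)
    (hl : ∀ p, (h p).map hT (hS p) ≫ l = (h p).map hT (hS p) ≫ l') : l = l' := by
  refine hT.hom_ext _ _ fun q hq => ?_
  obtain ⟨p, hp⟩ := hR' q hq
  simpa only [(h p).fac_map_assoc] using y p q hp ≫= hl p

variable [Preorder P] (hR : ∀ p₁ p₂, p₁ ≤ p₂ → ∀ q ∈ R p₁, q ∈ R p₂)

/-- The functor given by corepresenting objects for a monotone family of sets. -/
@[simps]
noncomputable def corepFunctor : P ⥤ K where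
  obj := F
  map f := (h _).map (h _) (hR _ _ (leOfHom f))
  map_id _ := (h _).map_self
  map_comp _ _ := ((h _).map_map (h _) (h _) _ _).symm

/-- The cocone given by a corepresenting object of a bigger set. -/
@[simps]
noncomputable def corepCocone (hT : IsCorep s att S T x) (hS : ∀ p, ∀ q ∈ R p, q ∈ S) :
    Cocone (corepFunctor R h hR) where
  pt := T
  ι := { app := fun p => (h p).map hT (hS p)
         naturality := fun _ _ _ => ((h _).map_map (h _) hT _ _).trans (comp_id _).symm }

/-- A corepresenting object of a directed union is the colimit of the corepresenting objects. -/
noncomputable def isColimitCorepCocone [IsDirectedOrder P] (hT : IsCorep s att S T x)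
    (hS : ∀ p, ∀ q ∈ R p, q ∈ S) (hR' : ∀ q ∈ S, ∃ p, q ∈ R p) :
    IsColimit (corepCocone R h hR hT hS) := by
  have H (c : Cocone (corepFunctor R h hR)) :=
    exists_desc_of_cover R h hT hS hR' (fun p => c.ι.app p) (by
      intro p p' q hq hq'
      obtain ⟨p'', h₁, h₂⟩ := exists_ge_ge p p'
      have w₁ : (h p).map (h p'') (hR _ _ h₁) ≫ c.ι.app p'' = c.ι.app p := c.w (homOfLE h₁)
      have w₂ : (h p').map (h p'') (hR _ _ h₂) ≫ c.ι.app p'' = c.ι.app p' := c.w (homOfLE h₂)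
      exact (congrArg (y p q hq ≫ ·) w₁.symm).trans (((h p).fac_map_assoc (h p'') _ q hq _).trans
        (((h p').fac_map_assoc (h p'') _ q hq' _).symm.trans (congrArg (y p' q hq' ≫ ·) w₂))))
  exact
    { desc := fun c => (H c).choose
      fac := fun c p => (H c).choose_spec p
      uniq := fun c m hm => hom_ext_of_cover R h hT hS hR' _ _ fun p =>
        (hm p).trans ((H c).choose_spec p).symm }

end Functoriality

end CellSystems

section Presentable

lemma isCardinalPresentable_sigmaObj [HasColimits K] (κ : Cardinal.{v}) [Fact κ.IsRegular]
    {ι : Type v} (f : ι → K) (hι : HasCardinalLT ι κ)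
    [∀ i, CategoryTheory.IsCardinalPresentable (f i) κ] :
    CategoryTheory.IsCardinalPresentable (∐ f) κ :=
  have (i : Discrete ι) : CategoryTheory.IsCardinalPresentable ((Discrete.functor f).obj i) κ := by
    dsimp; infer_instance
  isCardinalPresentable_of_isColimit _ (colimit.isColimit (Discrete.functor f)) κ
    (by rwa [hasCardinalLT_arrow_discrete_iff])

lemma isCardinalPresentable_coprod [HasColimits K] (κ : Cardinal.{v}) [Fact κ.IsRegular]
    (X Y : K) [CategoryTheory.IsCardinalPresentable X κ]
    [CategoryTheory.IsCardinalPresentable Y κ] :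
    CategoryTheory.IsCardinalPresentable (X ⨿ Y) κ :=
  have (i : Discrete WalkingPair) : CategoryTheory.IsCardinalPresentable ((pair X Y).obj i) κ := by
    obtain ⟨_ | _⟩ := i <;> dsimp <;> infer_instance
  isCardinalPresentable_of_isColimit _ (colimit.isColimit (pair X Y)) κ
    (hasCardinalLT_of_finite _ κ (Fact.out : κ.IsRegular).aleph0_le)

lemma isCardinalPresentable_coequalizer [HasColimits K] (κ : Cardinal.{v}) [Fact κ.IsRegular]
    {X Y : K} (f g : X ⟶ Y) [CategoryTheory.IsCardinalPresentable X κ]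
    [CategoryTheory.IsCardinalPresentable Y κ] :
    CategoryTheory.IsCardinalPresentable (coequalizer f g) κ :=
  have (i : WalkingParallelPair) :
      CategoryTheory.IsCardinalPresentable ((parallelPair f g).obj i) κ := by
    obtain _ | _ := i <;> dsimp <;> infer_instance
  isCardinalPresentable_of_isColimit _ (colimit.isColimit (parallelPair f g)) κ
    (hasCardinalLT_of_finite _ κ (Fact.out : κ.IsRegular).aleph0_le)

variable {Λ : Type v} {a b : Λ → K} (s : ∀ c, a c ⟶ b c) (att : ∀ c, Attach b (a c))

lemma isCardinalPresentable_corepObj [HasColimits K] (κ : Cardinal.{v}) [Fact κ.IsRegular]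
    (S : Set Λ) (hS : IsClosedUnder att S) (hcard : HasCardinalLT S κ)
    (hU : ∀ c ∈ S, HasCardinalLT (att c).U κ)
    [∀ c, CategoryTheory.IsCardinalPresentable (a c) κ]
    [∀ c, CategoryTheory.IsCardinalPresentable (b c) κ]
    (hL : ∀ c ∈ S, CategoryTheory.IsCardinalPresentable (att c).L κ) :
    CategoryTheory.IsCardinalPresentable (corepObj s att S hS) κ := by
  have (c : S) := hL c.1 c.2
  have h₁ : HasCardinalLT (Σ c : S, (att c).U) κ :=
    hasCardinalLT_sigma _ κ hcard fun c => hU c.1 c.2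
  have := isCardinalPresentable_sigmaObj κ (fun c : S => b c) hcard
  have := isCardinalPresentable_sigmaObj κ (fun c : S => (att c).L) hcard
  have := isCardinalPresentable_sigmaObj κ (fun c : S => a c) hcard
  have := isCardinalPresentable_sigmaObj κ (fun q : Σ c : S, (att c).U => b q.2) h₁
  have := isCardinalPresentable_coprod κ (∐ fun c : S => b c) (∐ fun c : S => (att c).L)
  have := isCardinalPresentable_coprod κ (∐ fun q : Σ c : S, (att c).U => b q.2)
    (∐ fun c : S => a c)
  exact isCardinalPresentable_coequalizer κ _ _

end Presentable

section Thinning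

lemma exists_fun_of_wellFounded {α : Type*} {β : α → Type*} {r : α → α → Prop}
    (wf : WellFounded r) (hr : ∀ x y z, r x y → r y z → r x z)
    (P : ∀ a, (∀ x, β x) → β a → Prop) (f₀ : ∀ x, β x)
    (hcongr : ∀ a f g b, (∀ x, r x a → f x = g x) → P a f b → P a g b)
    (step : ∀ a f, (∀ x, r x a → P x f (f x)) → ∃ b, P a f b) : ∃ f, ∀ a, P a f (f a) := by
  classical
  let ext (a : α) (g : ∀ x, r x a → β x) (x : α) : β x := if h : r x a then g x h else f₀ x
  let G (a : α) (g : ∀ x, r x a → β x) : β a :=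
    if h : ∃ b, P a (ext a g) b then h.choose else f₀ a
  let F := wf.fix G
  have hF (a : α) : F a = G a fun x _ => F x := wf.fix_eq G a
  have hext (a x : α) (h : r x a) : ext a (fun x _ => F x) x = F x := dif_pos h
  refine ⟨F, fun a => ?_⟩
  induction a using wf.induction with
  | _ a ih =>
    have h : ∃ b, P a (ext a fun x _ => F x) b := step a _ fun x hx => by
      rw [hext a x hx]
      exact hcongr _ _ _ _ (fun y hy => (hext a y (hr _ _ _ hy hx)).symm) (ih x hx)
    rw [hF, show G a (fun x _ => F x) = h.choose from dif_pos h]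
    exact hcongr _ _ _ _ (hext a) h.choose_spec

variable {Λ : Type v} {a b : Λ → K} (s : ∀ c, a c ⟶ b c) (att : ∀ c, Attach b (a c))
  (κ : Cardinal.{v}) [Fact κ.IsRegular]

/-- `A` is a small attaching datum for `c`, with respect to `att'`, which refines `att c`. -/
structure IsThinning (c : Λ) (att' : ∀ c, Attach b (a c)) (A : Attach b (a c)) : Prop where
  isCorep : IsCorep s att' A.U A.L A.x
  subset : ∀ q ∈ A.U, q ∈ (att c).U
  card : HasCardinalLT A.U κ
  presentable : CategoryTheory.IsCardinalPresentable A.L κ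
  exists_hom : ∃ m : A.L ⟶ (att c).L, (∀ q hq, A.x q hq ≫ m = (att c).x q (subset q hq)) ∧
    A.φ ≫ m = (att c).φ

variable {s att κ} {att' : ∀ c, Attach b (a c)}

lemma isSol_of_isThinning {S : Set Λ} (h : ∀ c ∈ S, IsThinning s att κ c att' (att' c))
    {W : K} {y : ∀ q ∈ S, (b q ⟶ W)} (hy : IsSol s att S y) : IsSol s att' S y := by
  intro c hc
  obtain ⟨hU, l, h₁, h₂⟩ := hy c hc
  obtain ⟨m, hm, hm'⟩ := (h c hc).exists_hom
  exact ⟨fun q hq => hU q ((h c hc).subset q hq), m ≫ l,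
    fun q hq => by rw [← assoc, hm, h₁], by rw [h₂, ← hm', assoc]⟩

lemma isSol_of_isSol_thinning (hv : ∀ c, IsValidAt s att c)
    (wf : WellFounded fun q c => q ∈ (att c).U) {S : Set Λ} (hS : IsClosedUnder att S)
    (h : ∀ c ∈ S, IsThinning s att κ c att' (att' c))
    {W : K} {y : ∀ q ∈ S, (b q ⟶ W)} (hy : IsSol s att' S y) : IsSol s att S y := by
  intro c
  induction c using wf.induction with
  | _ c ih =>
    intro hc
    have hy' : IsSol s att (att c).U fun q hq => y q (hS c hc q hq) := by
      intro q hq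
      obtain ⟨_, l, h₁, h₂⟩ := ih q hq (hS c hc q hq)
      exact ⟨(hv c).sol.isClosedUnder q hq, l, fun q hq => h₁ q hq, h₂⟩
    obtain ⟨l, hl⟩ := (hv c).exists_desc _ hy'
    obtain ⟨m, hm, hm'⟩ := (h c hc).exists_hom
    obtain ⟨hU, l', h₁, h₂⟩ := hy c hc
    refine ⟨hS c hc, l, hl, ?_⟩
    rw [h₂, ← hm', assoc]
    congr 1
    refine (h c hc).isCorep.hom_ext _ _ fun q hq => ?_
    rw [h₁, ← assoc, hm, hl]

lemma isCorep_of_isThinning (hv : ∀ c, IsValidAt s att c)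
    (wf : WellFounded fun q c => q ∈ (att c).U) {S : Set Λ} (hS : IsClosedUnder att S)
    (h : ∀ c ∈ S, IsThinning s att κ c att' (att' c)) {T : K} {x : ∀ q ∈ S, (b q ⟶ T)}
    (hT : IsCorep s att S T x) : IsCorep s att' S T x where
  sol := isSol_of_isThinning h hT.sol
  exists_desc y hy := hT.exists_desc y (isSol_of_isSol_thinning hv wf hS h hy)
  hom_ext := hT.hom_ext

lemma exists_isThinning_step [HasColimits K]
    [∀ c, CategoryTheory.IsCardinalPresentable (a c) κ]
    [∀ c, CategoryTheory.IsCardinalPresentable (b c) κ] (hv : ∀ c, IsValidAt s att c)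
    (wf : WellFounded fun q c => q ∈ (att c).U) (c : Λ)
    (h : ∀ q ∈ (att c).U, IsThinning s att κ q att' (att' q)) :
    ∃ A, IsThinning s att κ c att' A := by
  have hc : IsCorep s att' (att c).U (att c).L (att c).x :=
    isCorep_of_isThinning hv wf (hv c).sol.isClosedUnder h (hv c)
  let P := {R : Set Λ // (∀ q ∈ R, q ∈ (att c).U) ∧ IsClosedUnder att' R ∧ HasCardinalLT R κ}
  have hP : IsCardinalFiltered P κ := isCardinalFiltered_preorder _ _ fun ι R hι =>
    ⟨⟨⋃ i, (R i).1, by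
      simp only [Set.mem_iUnion]
      rintro q ⟨i, hi⟩
      exact (R i).2.1 q hi, by
      intro q hq q' hq'
      obtain ⟨i, hi⟩ := Set.mem_iUnion.1 hq
      exact Set.mem_iUnion.2 ⟨i, (R i).2.2.1 q hi q' hq'⟩,
      hasCardinalLT_iUnion _ ((hasCardinalLT_iff_cardinal_mk_lt _ _).2 hι) fun i => (R i).2.2.2⟩,
      fun i => Set.subset_iUnion (fun i => (R i).1) i⟩
  have := isFiltered_of_isCardinalFiltered P κ
  have : IsDirectedOrder P := ⟨fun p q => ⟨IsFiltered.max p q,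
    leOfHom (IsFiltered.leftToMax p q), leOfHom (IsFiltered.rightToMax p q)⟩⟩
  have hP' (R : P) := isCorep_corepObj s att' R.1 R.2.2.1 fun q hq => (h q (R.2.1 q hq)).isCorep
  let hcol := isColimitCorepCocone (fun R : P => R.1) hP' (fun R R' hR q hq =>
      Set.mem_of_subset_of_mem (show R.1 ⊆ R'.1 from hR) hq) hc
    (fun R => R.2.1) (fun q hq => ⟨⟨insert q (att' q).U, by
      rintro q' (rfl | hq')
      · exact hq
      · exact (hv c).sol.isClosedUnder q hq q' ((h q hq).subset q' hq'), by
      rintro q' (rfl | hq') q'' hq''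
      · exact Or.inr hq''
      · exact Or.inr ((h q hq).isCorep.sol.isClosedUnder q' hq' q'' hq''), by
      rw [Set.insert_eq]
      exact hasCardinalLT_union (Fact.out : κ.IsRegular).aleph0_le
        (hasCardinalLT_of_finite _ _ (Fact.out : κ.IsRegular).aleph0_le) (h q hq).card⟩,
      Set.mem_insert _ _⟩)
  obtain ⟨R, φ, hφ⟩ := CategoryTheory.IsCardinalPresentable.exists_hom_of_isColimit κ hcol (att c).φ
  exact ⟨⟨R.1, corepObj s att' R.1 R.2.2.1, _, φ⟩, hP' R, R.2.1, R.2.2.2,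
    isCardinalPresentable_corepObj s att' κ R.1 R.2.2.1 R.2.2.2
      (fun q hq => (h q (R.2.1 q hq)).card) (fun q hq => (h q (R.2.1 q hq)).presentable),
    (hP' R).map hc R.2.1, fun q hq => (hP' R).fac_map hc R.2.1 q hq, hφ⟩

/-- Every cell system can be replaced by one in which the cells have small boundaries. -/
theorem exists_isThinning [HasColimits K]
    [∀ c, CategoryTheory.IsCardinalPresentable (a c) κ]
    [∀ c, CategoryTheory.IsCardinalPresentable (b c) κ] (hv : ∀ c, IsValidAt s att c)
    (wf : WellFounded fun q c => q ∈ (att c).U) :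
    ∃ att' : ∀ c, Attach b (a c), ∀ c, IsThinning s att κ c att' (att' c) := by
  refine exists_fun_of_wellFounded wf (fun q c d h h' => (hv d).sol.isClosedUnder c h' q h)
    (fun c att' A => IsThinning s att κ c att' A) att ?_
    fun c att' h => exists_isThinning_step hv wf c h
  intro c f g A hfg h
  exact { h with isCorep := h.isCorep.congr_att fun q hq => hfg q (h.subset q hq) }

end Thinning

section Sum

variable {Λ₁ Λ₂ : Type v}

/-- The family of objects indexed by a disjoint union. -/
abbrev sumFam (f₁ : Λ₁ → K) (f₂ : Λ₂ → K) (z : Λ₁ ⊕ Λ₂) : K :=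
  match z with
  | .inl q => f₁ q
  | .inr q => f₂ q

/-- The family of morphisms indexed by a disjoint union. -/
abbrev sumHom {a₁ b₁ : Λ₁ → K} {a₂ b₂ : Λ₂ → K} (s₁ : ∀ q, a₁ q ⟶ b₁ q) (s₂ : ∀ q, a₂ q ⟶ b₂ q)
    (z : Λ₁ ⊕ Λ₂) : sumFam a₁ a₂ z ⟶ sumFam b₁ b₂ z :=
  match z with
  | .inl q => s₁ q
  | .inr q => s₂ q

/-- The union of a subset of the left and a subset of the right component. -/
abbrev sumSet (S₁ : Set Λ₁) (S₂ : Set Λ₂) : Set (Λ₁ ⊕ Λ₂) :=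
  {z | match z with
    | .inl q => q ∈ S₁
    | .inr q => q ∈ S₂}

/-- The family of maps to `W` indexed by a disjoint union. -/
abbrev sumDesc {b₁ : Λ₁ → K} {b₂ : Λ₂ → K} {S₁ : Set Λ₁} {S₂ : Set Λ₂} {W : K}
    (x₁ : ∀ q ∈ S₁, (b₁ q ⟶ W)) (x₂ : ∀ q ∈ S₂, (b₂ q ⟶ W)) (z : Λ₁ ⊕ Λ₂)
    (hz : z ∈ sumSet S₁ S₂) : sumFam b₁ b₂ z ⟶ W :=
  match z, hz with
  | .inl q, hq => x₁ q hq
  | .inr q, hq => x₂ q hq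

end Sum

section Extension

open HomotopicalAlgebra

variable {Λ₁ : Type v} {a₁ b₁ : Λ₁ → K} {s₁ : ∀ q, a₁ q ⟶ b₁ q} (att₁ : ∀ q, Attach b₁ (a₁ q))
  {X Z : K} (x₁ : ∀ q, b₁ q ⟶ X) {f : X ⟶ Z}
  {J : Type v} [LinearOrder J] [OrderBot J] [SuccOrder J] [WellFoundedLT J]
  {α : Type u'} {A B : α → K} {g : ∀ i, A i ⟶ B i} (c : RelativeCellComplex.{v} (fun _ : J => g) f)

/-- The index of the cell `δ` in the generating family. -/
abbrev cellIdx (δ : c.Cells) : α := (c.attachCells δ.j δ.hj).π δ.k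

/-- The inclusion of the cell `δ` in a stage. -/
noncomputable def cellTo (δ : c.Cells) (j : J) (h : δ.j < j) : B (cellIdx c δ) ⟶ c.F.obj j :=
  (c.attachCells δ.j δ.hj).cell δ.k ≫ c.F.map (homOfLE (Order.succ_le_of_lt h))

/-- The inclusion of the bottom in a stage. -/
noncomputable def botTo (j : J) : X ⟶ c.F.obj j := c.isoBot.inv ≫ c.F.map (homOfLE bot_le)

lemma cellTo_map (δ : c.Cells) (j j' : J) (h : δ.j < j) (h' : j ≤ j') :
    cellTo c δ j h ≫ c.F.map (homOfLE h') = cellTo c δ j' (h.trans_le h') := by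
  rw [cellTo, cellTo, assoc, ← Functor.map_comp, homOfLE_comp]

lemma cellTo_map_assoc (δ : c.Cells) (j j' : J) (h : δ.j < j) (h' : j ≤ j') {W : K}
    (g : c.F.obj j' ⟶ W) :
    cellTo c δ j h ≫ c.F.map (homOfLE h') ≫ g = cellTo c δ j' (h.trans_le h') ≫ g := by
  rw [← assoc, cellTo_map]

lemma botTo_map (j j' : J) (h' : j ≤ j') :
    botTo c j ≫ c.F.map (homOfLE h') = botTo c j' := by
  rw [botTo, botTo, assoc, ← Functor.map_comp, homOfLE_comp]

lemma botTo_map_assoc (j j' : J) (h' : j ≤ j') {W : K} (g : c.F.obj j' ⟶ W) :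
    botTo c j ≫ c.F.map (homOfLE h') ≫ g = botTo c j' ≫ g := by
  rw [← assoc, botTo_map]

lemma map_incl (j j' : J) (h : j ≤ j') :
    c.F.map (homOfLE h) ≫ c.incl.app j' = c.incl.app j :=
  (c.incl.naturality _).trans (comp_id _)

/-- The inclusion of the cell `δ` in the complex. -/
noncomputable def cellIn (δ : c.Cells) : B (cellIdx c δ) ⟶ Z :=
  (c.attachCells δ.j δ.hj).cell δ.k ≫ c.incl.app _

lemma cellTo_incl (δ : c.Cells) (j : J) (h : δ.j < j) :
    cellTo c δ j h ≫ c.incl.app j = cellIn c δ := by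
  rw [cellTo, assoc, map_incl, cellIn]

lemma botTo_incl (j : J) : botTo c j ≫ c.incl.app j = f := by
  rw [botTo, assoc, map_incl]
  exact c.fac

lemma cellTo_succ (δ : c.Cells) (h : δ.j < Order.succ δ.j) :
    cellTo c δ _ h = (c.attachCells δ.j δ.hj).cell δ.k := by
  rw [cellTo]
  exact (congrArg (_ ≫ ·) (c.F.map_id _)).trans (comp_id _)

/-- The attaching map of the cell `δ`. -/
noncomputable def cellAttach (δ : c.Cells) : A (cellIdx c δ) ⟶ c.F.obj δ.j :=
  (c.attachCells δ.j δ.hj).cofan₁.inj δ.k ≫ (c.attachCells δ.j δ.hj).g₁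

lemma comp_cell (δ : c.Cells) : g (cellIdx c δ) ≫ (c.attachCells δ.j δ.hj).cell δ.k =
    cellAttach c δ ≫ c.F.map (homOfLE (Order.le_succ δ.j)) := by
  rw [AttachCells.cell_def, ← AttachCells.hm_assoc, cellAttach, assoc,
    (c.attachCells δ.j δ.hj).isPushout.w]

lemma comp_cellTo (δ : c.Cells) (j : J) (h : δ.j < j) :
    g (cellIdx c δ) ≫ cellTo c δ j h = cellAttach c δ ≫ c.F.map (homOfLE h.le) := by
  rw [cellTo, ← assoc, comp_cell, assoc, ← Functor.map_comp, homOfLE_comp]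

lemma comp_cellIn (δ : c.Cells) :
    g (cellIdx c δ) ≫ cellIn c δ = cellAttach c δ ≫ c.incl.app δ.j := by
  rw [cellIn, ← assoc, comp_cell, assoc, map_incl]

/-- The boundary maps of the cells of the extended complex. -/
noncomputable abbrev extS (s₁ : ∀ q, a₁ q ⟶ b₁ q) (z : Λ₁ ⊕ c.Cells) :
    sumFam a₁ (fun δ => A (cellIdx c δ)) z ⟶ sumFam b₁ (fun δ => B (cellIdx c δ)) z :=
  sumHom s₁ (fun δ => g (cellIdx c δ)) z

/-- The cells of the extended complex in a stage. -/
noncomputable abbrev extX (j : J) (z : Λ₁ ⊕ c.Cells)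
    (hz : z ∈ sumSet Set.univ {δ : c.Cells | δ.j < j}) :
    sumFam b₁ (fun δ => B (cellIdx c δ)) z ⟶ c.F.obj j :=
  sumDesc (S₁ := Set.univ) (S₂ := {δ : c.Cells | δ.j < j}) (fun q _ => x₁ q ≫ botTo c j)
    (fun δ hδ => cellTo c δ j hδ) z hz

/-- The attaching data of the extended complex. -/
noncomputable abbrev extAtt (z : Λ₁ ⊕ c.Cells) :
    Attach (sumFam b₁ (fun δ => B (cellIdx c δ))) (sumFam a₁ (fun δ => A (cellIdx c δ)) z) :=
  match z with
  | .inl q =>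
    { U := sumSet (att₁ q).U ∅
      L := (att₁ q).L
      x := sumDesc (S₂ := ∅) (att₁ q).x (fun _ h => h.elim)
      φ := (att₁ q).φ }
  | .inr δ =>
    { U := sumSet Set.univ {δ' | δ'.j < δ.j}
      L := c.F.obj δ.j
      x := extX x₁ c δ.j
      φ := cellAttach c δ }

lemma wellFounded_extAtt (wf : WellFounded fun q c => q ∈ (att₁ c).U) :
    WellFounded fun z z' => z ∈ (extAtt att₁ x₁ c z').U := by
  have hl (q : Λ₁) : Acc (fun z z' => z ∈ (extAtt att₁ x₁ c z').U) (.inl q) := by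
    induction q using wf.induction with
    | _ q ih =>
      refine ⟨_, ?_⟩
      rintro (q' | δ) h
      · exact ih q' h
      · exact h.elim
  have hr (j : J) : ∀ δ : c.Cells, δ.j = j →
      Acc (fun z z' => z ∈ (extAtt att₁ x₁ c z').U) (.inr δ) := by
    induction j using WellFoundedLT.induction with
    | _ j ih =>
      rintro δ rfl
      refine ⟨_, ?_⟩
      rintro (q' | δ') h
      · exact hl q'
      · exact ih _ h _ rfl
  exact ⟨fun z => match z with
    | .inl q => hl q
    | .inr δ => hr _ δ rfl⟩

variable {att₁ x₁}

lemma IsSol.inl {S₁ : Set Λ₁} {S₂ : Set c.Cells} {W : K}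
    {y : ∀ q ∈ sumSet S₁ S₂, (sumFam b₁ (fun δ => B (cellIdx c δ)) q ⟶ W)}
    (hy : IsSol (extS c s₁) (extAtt att₁ x₁ c) (sumSet S₁ S₂) y) :
    IsSol s₁ att₁ S₁ fun q hq => y (.inl q) hq := by
  intro q hq
  obtain ⟨hU, l, h₁, h₂⟩ := hy (.inl q) hq
  exact ⟨fun q' hq' => hU (.inl q') hq', l, fun q' hq' => h₁ (.inl q') hq', h₂⟩

lemma IsCorep.inl {S₁ : Set Λ₁} {T : K} {x : ∀ q ∈ S₁, (b₁ q ⟶ T)} (h : IsCorep s₁ att₁ S₁ T x) :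
    IsCorep (extS c s₁) (extAtt att₁ x₁ c) (sumSet S₁ ∅) T
      (sumDesc (S₂ := ∅) x (fun _ h => h.elim)) where
  sol := by
    rintro (q | δ) hq
    · obtain ⟨hU, l, h₁, h₂⟩ := h.sol q hq
      refine ⟨?_, l, ?_, h₂⟩
      · rintro (q' | δ) hq'
        · exact hU q' hq'
        · exact hq'.elim
      · rintro (q' | δ) hq'
        · exact h₁ q' hq'
        · exact hq'.elim
    · exact hq.elim
  exists_desc y hy := by
    obtain ⟨l, hl⟩ := h.exists_desc _ (hy.inl c)
    refine ⟨l, ?_⟩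
    rintro (q | δ) hq
    · exact hl q hq
    · exact hq.elim
  hom_ext l l' hl := h.hom_ext _ _ fun q hq => hl (.inl q) hq

lemma isSol_ext (hX : IsCorep s₁ att₁ Set.univ X (fun q _ => x₁ q)) {S₂ : Set c.Cells}
    (hS : ∀ δ ∈ S₂, ∀ δ' : c.Cells, δ'.j < δ.j → δ' ∈ S₂) {W : K}
    (y : ∀ q ∈ sumSet Set.univ S₂, (sumFam b₁ (fun δ => B (cellIdx c δ)) q ⟶ W))
    (w : X ⟶ W) (hw : ∀ q, y (.inl q) (Set.mem_univ q) = x₁ q ≫ w)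
    (l : ∀ δ ∈ S₂, c.F.obj (δ : c.Cells).j ⟶ W)
    (hl : ∀ δ hδ, botTo c (δ : c.Cells).j ≫ l δ hδ = w)
    (hl' : ∀ δ hδ δ' (h : δ'.j < δ.j), cellTo c δ' _ h ≫ l δ hδ = y (.inr δ') (hS δ hδ δ' h))
    (hl'' : ∀ δ hδ, g (cellIdx c δ) ≫ y (.inr δ) hδ = cellAttach c δ ≫ l δ hδ) :
    IsSol (extS c s₁) (extAtt att₁ x₁ c) (sumSet Set.univ S₂) y := by
  rintro (q | δ) hq
  · obtain ⟨_, l, h₁, h₂⟩ := hX.sol q (Set.mem_univ _)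
    refine ⟨?_, l ≫ w, ?_, ?_⟩
    · rintro (q' | δ) hq'
      · exact Set.mem_univ q'
      · exact hq'.elim
    · rintro (q' | δ) hq'
      · exact (assoc _ _ _).symm.trans ((congrArg (· ≫ w) (h₁ q' hq')).trans (hw q').symm)
      · exact hq'.elim
    · exact (congrArg (s₁ q ≫ ·) (hw q)).trans ((assoc _ _ _).symm.trans
        ((congrArg (· ≫ w) h₂).trans (assoc _ _ _)))
  · refine ⟨?_, l δ hq, ?_, hl'' δ hq⟩
    · rintro (q' | δ') hq'
      · exact Set.mem_univ q'
      · exact hS δ hq δ' hq'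
    · rintro (q' | δ') hq'
      · exact (assoc _ _ _).trans ((congrArg (x₁ q' ≫ ·) (hl δ hq)).trans (hw q').symm)
      · exact hl' δ hq δ' hq'

lemma isSol_extX (hX : IsCorep s₁ att₁ Set.univ X (fun q _ => x₁ q)) (j : J) :
    IsSol (extS c s₁) (extAtt att₁ x₁ c) (sumSet Set.univ {δ : c.Cells | δ.j < j}) (extX x₁ c j) :=
  isSol_ext c hX (fun _ (hδ : _ < j) _ hδ' => hδ'.trans hδ) _ (botTo c j) (fun _ => rfl)
    (fun _ hδ => c.F.map (homOfLE (le_of_lt hδ))) (fun _ _ => botTo_map c _ _ _)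
    (fun _ _ _ _ => cellTo_map c _ _ _ _ _) (fun _ _ => comp_cellTo c _ _ _)

/-- Recognition of corepresenting objects which are colimits of stages. -/
lemma exists_desc_of_isCorep_stages {Q : Set J} {T : K}
    (i₀ : J) (hi₀ : i₀ ∈ Q) (ι : ∀ j ∈ Q, c.F.obj j ⟶ T)
    {S₂ : Set c.Cells}
    (hS : ∀ j ∈ Q, ∀ δ : c.Cells, δ.j < j → δ ∈ S₂)
    (h : ∀ j ∈ Q, IsCorep (extS c s₁) (extAtt att₁ x₁ c) (sumSet Set.univ {δ : c.Cells | δ.j < j})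
      (c.F.obj j) (extX x₁ c j))
    {W : K} (y : ∀ q ∈ sumSet Set.univ S₂, (sumFam b₁ (fun δ => B (cellIdx c δ)) q ⟶ W))
    (hy : IsSol (extS c s₁) (extAtt att₁ x₁ c) (sumSet Set.univ S₂) y)
    (hdesc : ∀ (l : ∀ i ∈ Q, c.F.obj i ⟶ W), (∀ j j' (hj : j ∈ Q) (hj' : j' ∈ Q) (h : j ≤ j'),
      c.F.map (homOfLE h) ≫ l j' hj' = l j hj) → ∃ l' : T ⟶ W, ∀ j hj, ι j hj ≫ l' = l j hj) :
    ∃ l : T ⟶ W, (∀ q, (x₁ q ≫ botTo c i₀ ≫ ι i₀ hi₀) ≫ l = y (.inl q) (Set.mem_univ q)) ∧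
      ∀ j hj δ (hδ : δ.j < j), (cellTo c δ j hδ ≫ ι j hj) ≫ l = y (.inr δ) (hS j hj δ hδ) := by
  have hsub (j : J) (hj : j ∈ Q) (z) (hz : z ∈ sumSet (Set.univ : Set Λ₁) {δ : c.Cells | δ.j < j}) :
      z ∈ sumSet Set.univ S₂ := by
    rcases z with q | δ
    · exact Set.mem_univ q
    · exact hS j hj δ hz
  have hy' (j : J) (hj : j ∈ Q) := (h j hj).exists_desc
    (fun z hz => y z (hsub j hj z hz)) (hy.restrict (hsub j hj) (h j hj).sol.isClosedUnder)
  choose l hl using hy'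
  obtain ⟨l', hl'⟩ := hdesc l (fun j j' hj hj' hjj' => (h j hj).hom_ext _ _ (by
    rintro (q | δ) hq
    · refine Eq.trans ?_ ((hl j' hj' (.inl q) (Set.mem_univ q)).trans (hl j hj (.inl q) hq).symm)
      show (x₁ q ≫ botTo c j) ≫ _ = (x₁ q ≫ botTo c j') ≫ _
      rw [assoc, botTo_map_assoc, assoc]
    · refine Eq.trans ?_ ((hl j' hj' (.inr δ) (lt_of_lt_of_le hq hjj')).trans
        (hl j hj (.inr δ) hq).symm)
      exact cellTo_map_assoc c δ j j' hq hjj' _))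
  refine ⟨l', fun q => ?_, fun j hj δ hδ => ?_⟩
  · rw [assoc, assoc, hl']
    exact (assoc _ _ _).symm.trans (hl i₀ hi₀ (.inl q) (Set.mem_univ q))
  · rw [assoc, hl']
    exact hl j hj (.inr δ) hδ

lemma isCorep_ext_stage (hX : IsCorep s₁ att₁ Set.univ X (fun q _ => x₁ q)) (j : J) :
    IsCorep (extS c s₁) (extAtt att₁ x₁ c) (sumSet Set.univ {δ : c.Cells | δ.j < j})
      (c.F.obj j) (extX x₁ c j) := by
  induction j using SuccOrder.limitRecOn with
  | isMin j hj =>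
    obtain rfl := hj.eq_bot
    have h₀ : botTo c (⊥ : J) = c.isoBot.inv :=
      (congrArg (_ ≫ ·) (c.F.map_id _)).trans (comp_id _)
    refine ⟨isSol_extX c hX _, fun {W} y hy => ?_, fun {W} l l' h => ?_⟩
    · obtain ⟨l, hl⟩ := hX.exists_desc _ (hy.inl c)
      refine ⟨c.isoBot.hom ≫ l, ?_⟩
      rintro (q | δ) hq
      · show (x₁ q ≫ botTo c (⊥ : J)) ≫ _ = _
        rw [h₀, assoc, Iso.inv_hom_id_assoc]
        exact hl q hq
      · exact (not_lt_bot hq).elim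
    · rw [← cancel_epi c.isoBot.inv]
      refine hX.hom_ext _ _ fun q hq => ?_
      have : (x₁ q ≫ botTo c (⊥ : J)) ≫ l = (x₁ q ≫ botTo c (⊥ : J)) ≫ l' := h (.inl q) hq
      rwa [h₀, assoc, assoc] at this
  | succ j hj ih =>
    refine ⟨isSol_extX c hX _, fun {W} y hy => ?_, fun {W} l l' h => ?_⟩
    · have hlt {δ : c.Cells} (h : δ.j < j) : δ.j < Order.succ j :=
        h.trans (Order.lt_succ_of_not_isMax hj)
      have hsub (z) (hz : z ∈ sumSet (Set.univ : Set Λ₁) {δ : c.Cells | δ.j < j}) :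
          z ∈ sumSet Set.univ {δ : c.Cells | δ.j < Order.succ j} := by
        rcases z with q | δ
        · exact hz
        · exact hlt hz
      obtain ⟨l, hl⟩ := ih.exists_desc (fun z hz => y z (hsub z hz))
        (hy.restrict hsub ih.sol.isClosedUnder)
      have hk (k : (c.attachCells j hj).ι) : g ((c.attachCells j hj).π k) ≫
          y (.inr ⟨j, hj, k⟩) (Order.lt_succ_of_not_isMax hj) =
            cellAttach c ⟨j, hj, k⟩ ≫ l := by
        obtain ⟨hU, l', h₁, h₂⟩ := hy (.inr ⟨j, hj, k⟩) (Order.lt_succ_of_not_isMax hj)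
        refine h₂.trans (congrArg (cellAttach c ⟨j, hj, k⟩ ≫ ·) ?_)
        exact ih.hom_ext _ _ fun z hz => (h₁ z hz).trans (hl z hz).symm
      let m := Cofan.IsColimit.desc (c.attachCells j hj).isColimit₂
        (fun k => y (.inr ⟨j, hj, k⟩) (Order.lt_succ_of_not_isMax hj))
      have hm (k) : (c.attachCells j hj).cofan₂.inj k ≫ m =
        y (.inr ⟨j, hj, k⟩) (Order.lt_succ_of_not_isMax hj) := Cofan.IsColimit.fac _ _ _
      have w : (c.attachCells j hj).g₁ ≫ l = (c.attachCells j hj).m ≫ m := by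
        refine Cofan.IsColimit.hom_ext (c.attachCells j hj).isColimit₁ _ _ fun k => ?_
        rw [AttachCells.hm_assoc, hm, hk, cellAttach, assoc]
      refine ⟨(c.attachCells j hj).isPushout.desc l m w, ?_⟩
      have hinl := (c.attachCells j hj).isPushout.inl_desc l m w
      have hinr := (c.attachCells j hj).isPushout.inr_desc l m w
      rintro (q | δ) hq
      · refine Eq.trans ?_ (hl (.inl q) hq)
        show (x₁ q ≫ botTo c _) ≫ _ = (x₁ q ≫ botTo c j) ≫ _
        rw [← botTo_map c j _ (Order.le_succ j), assoc, assoc, hinl, assoc]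
      · have hδ : δ.j ≤ j := (Order.lt_succ_iff_of_not_isMax hj).1 hq
        obtain hδ | hδ := hδ.lt_or_eq
        · refine Eq.trans ?_ (hl (.inr δ) hδ)
          show cellTo c δ _ _ ≫ _ = cellTo c δ _ _ ≫ _
          rw [← cellTo_map c δ j _ hδ (Order.le_succ j), assoc, hinl]
        · obtain ⟨i, hi, k⟩ := δ
          dsimp only at hδ
          subst hδ
          show cellTo c ⟨i, hi, k⟩ _ _ ≫ _ = _
          rw [cellTo_succ, AttachCells.cell_def, assoc, hinr]
          exact hm k
    · refine (c.attachCells j hj).hom_ext ?_ fun k => ?_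
      · refine ih.hom_ext _ _ ?_
        rintro (q | δ) hq
        · have : (x₁ q ≫ botTo c _) ≫ l = (x₁ q ≫ botTo c _) ≫ l' := h (.inl q) hq
          rw [← botTo_map c j _ (Order.le_succ j), assoc, assoc, assoc, assoc] at this
          exact (assoc _ _ _).trans (this.trans (assoc _ _ _).symm)
        · have : cellTo c δ _ _ ≫ l = cellTo c δ _ _ ≫ l' :=
            h (.inr δ) (lt_trans hq (Order.lt_succ_of_not_isMax hj))
          rw [← cellTo_map c δ j _ hq (Order.le_succ j), assoc, assoc] at this
          exact this
      · have : cellTo c ⟨j, hj, k⟩ _ _ ≫ l = cellTo c ⟨j, hj, k⟩ _ _ ≫ l' :=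
          h (.inr ⟨j, hj, k⟩) (Order.lt_succ_of_not_isMax hj)
        rwa [cellTo_succ] at this
  | isSuccLimit j hj ih =>
    let hc := c.F.isColimitOfIsWellOrderContinuous j hj
    have hbot : (⊥ : J) < j := hj.bot_lt
    refine ⟨isSol_extX c hX _, fun {W} y hy => ?_, fun {W} l l' h => ?_⟩
    · obtain ⟨l, hl, hl'⟩ := exists_desc_of_isCorep_stages c (Q := Set.Iio j) ⊥ hbot
        (fun i hi => c.F.map (homOfLE (le_of_lt hi)))
        (S₂ := {δ | δ.j < j}) (fun i hi δ hδ => lt_trans hδ hi) (fun i hi => ih i hi) y hy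
        (fun l hl => ⟨hc.desc ⟨W, { app := fun i => l i.1 i.2
                                    naturality := fun i i' h => (hl _ _ _ _ (leOfHom h)).trans
                                      (comp_id _).symm }⟩,
          fun i hi => hc.fac _ ⟨i, hi⟩⟩)
      refine ⟨l, ?_⟩
      rintro (q | δ) hq
      · refine Eq.trans ?_ (hl q)
        show (x₁ q ≫ botTo c j) ≫ _ = _
        rw [botTo_map]
      · refine Eq.trans ?_ (hl' _ (hj.succ_lt hq) δ (Order.lt_succ_of_not_isMax δ.hj))
        show cellTo c δ _ _ ≫ _ = _
        rw [cellTo_map]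
    · refine hc.hom_ext fun ⟨i, hi⟩ => ?_
      refine (ih i hi).hom_ext _ _ ?_
      have hij : i ≤ j := le_of_lt hi
      rintro (q | δ) hq
      · have : (x₁ q ≫ botTo c _) ≫ l = (x₁ q ≫ botTo c _) ≫ l' := h (.inl q) hq
        rw [← botTo_map c i _ hij, assoc, assoc, assoc, assoc] at this
        exact (assoc _ _ _).trans (this.trans (assoc _ _ _).symm)
      · have : cellTo c δ _ _ ≫ l = cellTo c δ _ _ ≫ l' := h (.inr δ) (lt_trans hq hi)
        rw [← cellTo_map c δ i _ hq hij, assoc, assoc] at this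
        exact this

/-- The maps from the cells of the extended complex to its colimit. -/
noncomputable abbrev extTop (x₁ : ∀ q, b₁ q ⟶ X) (z : Λ₁ ⊕ c.Cells)
    (hz : z ∈ sumSet Set.univ (Set.univ : Set c.Cells)) :
    sumFam b₁ (fun δ => B (cellIdx c δ)) z ⟶ Z :=
  sumDesc (S₁ := Set.univ) (S₂ := Set.univ) (fun q _ => x₁ q ≫ f) (fun δ _ => cellIn c δ) z hz

lemma isCorep_extTop (hX : IsCorep s₁ att₁ Set.univ X (fun q _ => x₁ q)) :
    IsCorep (extS c s₁) (extAtt att₁ x₁ c) (sumSet Set.univ Set.univ) Z (extTop c x₁) := by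
  have ih (j : J) := isCorep_ext_stage c hX j
  refine ⟨?_, fun {W} y hy => ?_, fun {W} l l' h => ?_⟩
  · exact isSol_ext c hX (fun _ _ _ _ => Set.mem_univ _) _ f (fun _ => rfl)
      (fun δ _ => c.incl.app δ.j) (fun _ _ => botTo_incl c _) (fun _ _ _ _ => cellTo_incl c _ _ _)
      (fun δ _ => comp_cellIn c δ)
  · obtain ⟨l, hl, hl'⟩ := exists_desc_of_isCorep_stages c (Q := Set.univ) ⊥ (Set.mem_univ _)
      (fun i _ => c.incl.app i)
      (S₂ := Set.univ) (fun _ _ _ _ => Set.mem_univ _) (fun i _ => ih i) y hy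
      (fun l hl => ⟨c.isColimit.desc ⟨W,
          { app := fun i => l i (Set.mem_univ _)
            naturality := fun i i' h => (hl _ _ _ _ (leOfHom h)).trans (comp_id _).symm }⟩,
        fun i _ => c.isColimit.fac _ i⟩)
    refine ⟨l, ?_⟩
    rintro (q | δ) hq
    · refine Eq.trans ?_ (hl q)
      show (x₁ q ≫ f) ≫ _ = _
      rw [botTo_incl]
    · refine Eq.trans ?_ (hl' _ (Set.mem_univ _) δ (Order.lt_succ_of_not_isMax δ.hj))
      show cellIn c δ ≫ _ = _
      rw [cellTo_incl]
  · refine c.isColimit.hom_ext fun i => ?_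
    refine (ih i).hom_ext _ _ ?_
    rintro (q | δ) hq
    · have : (x₁ q ≫ f) ≫ l = (x₁ q ≫ f) ≫ l' := h (.inl q) hq
      rw [← botTo_incl c i, assoc, assoc, assoc, assoc] at this
      exact (assoc _ _ _).trans (this.trans (assoc _ _ _).symm)
    · have : cellIn c δ ≫ l = cellIn c δ ≫ l' := h (.inr δ) (Set.mem_univ δ)
      rw [← cellTo_incl c δ i hq, assoc, assoc] at this
      exact this

/-- The extended complex is valid. -/
lemma isValidAt_extAtt (hv : ∀ q, IsValidAt s₁ att₁ q)
    (hX : IsCorep s₁ att₁ Set.univ X (fun q _ => x₁ q)) (z : Λ₁ ⊕ c.Cells) :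
    IsValidAt (extS c s₁) (extAtt att₁ x₁ c) z :=
  match z with
  | .inl q => (hv q).inl c
  | .inr δ => isCorep_ext_stage c hX δ.j

end Extension

section Gluing

variable {Λ : Type v} [PartialOrder Λ]

/-- The functor `T` on lower sets is glued from its values on principal lower sets. -/
structure IsGluing (T : LowerSet Λ ⥤ K) : Prop where
  exists_desc : ∀ (S : LowerSet Λ) {W : K} (f : ∀ c ∈ S, T.obj (LowerSet.Iic c) ⟶ W),
    (∀ c c' (hc : c ∈ S) (h : c' ≤ c), T.map (homOfLE (LowerSet.Iic_le.2 h)) ≫ f c hc =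
      f c' (S.lower h hc)) →
    ∃ l : T.obj S ⟶ W, ∀ c hc, T.map (homOfLE (LowerSet.Iic_le.2 hc)) ≫ l = f c hc
  hom_ext : ∀ (S : LowerSet Λ) {W : K} (l₁ l₂ : T.obj S ⟶ W),
    (∀ c (hc : c ∈ S), T.map (homOfLE (LowerSet.Iic_le.2 hc)) ≫ l₁ =
      T.map (homOfLE (LowerSet.Iic_le.2 hc)) ≫ l₂) → l₁ = l₂

lemma map_homOfLE_comp {P : Type*} [Preorder P] (T : P ⥤ K) {p p' p'' : P} (h : p ≤ p')
    (h' : p' ≤ p'') :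
    T.map (homOfLE h) ≫ T.map (homOfLE h') = T.map (homOfLE (h.trans h')) := by
  rw [← T.map_comp, homOfLE_comp]

lemma map_homOfLE_comp_assoc {P : Type*} [Preorder P] (T : P ⥤ K) {p p' p'' : P} (h : p ≤ p')
    (h' : p' ≤ p'') {W : K} (g : T.obj p'' ⟶ W) :
    T.map (homOfLE h) ≫ T.map (homOfLE h') ≫ g = T.map (homOfLE (h.trans h')) ≫ g := by
  rw [← assoc, map_homOfLE_comp]

lemma map_homOfLE_refl {P : Type*} [Preorder P] (T : P ⥤ K) {p : P} (h : p ≤ p) :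
    T.map (homOfLE h) = 𝟙 _ := T.map_id _

namespace IsGluing

variable {T : LowerSet Λ ⥤ K}

lemma exists_desc_of_cover (hT : IsGluing T) {ι : Sort*} (S : ι → LowerSet Λ)
    {S' : LowerSet Λ} (hS : ∀ i, S i ≤ S')
    (hS' : ∀ c ∈ S', ∃ i, c ∈ S i) {W : K} (l : ∀ i, T.obj (S i) ⟶ W)
    (hl : ∀ i j c (hi : c ∈ S i) (hj : c ∈ S j), T.map (homOfLE (LowerSet.Iic_le.2 hi)) ≫ l i =
      T.map (homOfLE (LowerSet.Iic_le.2 hj)) ≫ l j) :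
    ∃ l' : T.obj S' ⟶ W, ∀ i, T.map (homOfLE (hS i)) ≫ l' = l i := by
  choose i hi using hS'
  obtain ⟨l', hl'⟩ := hT.exists_desc S'
    (fun c hc => T.map (homOfLE (LowerSet.Iic_le.2 (hi c hc))) ≫ l (i c hc))
    (fun c c' hc h => by
      rw [map_homOfLE_comp_assoc]
      exact hl _ _ _ ((S _).lower h (hi c hc)) (hi c' _))
  refine ⟨l', fun j => hT.hom_ext _ _ _ fun c hc => ?_⟩
  rw [map_homOfLE_comp_assoc, hl' c (hS j hc)]
  exact hl _ _ _ (hi c _) hc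

lemma hom_ext_of_cover (hT : IsGluing T) {ι : Sort*} (S : ι → LowerSet Λ)
    {S' : LowerSet Λ} (hS : ∀ i, S i ≤ S')
    (hS' : ∀ c ∈ S', ∃ i, c ∈ S i) {W : K} (l l' : T.obj S' ⟶ W)
    (hl : ∀ i, T.map (homOfLE (hS i)) ≫ l = T.map (homOfLE (hS i)) ≫ l') : l = l' := by
  refine hT.hom_ext _ _ _ fun c hc => ?_
  obtain ⟨i, hi⟩ := hS' c hc
  simpa only [map_homOfLE_comp_assoc] using
    T.map (homOfLE (LowerSet.Iic_le.2 hi)) ≫= hl i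

/-- The value of `T` on a directed union is a colimit. -/
noncomputable def isColimitOfDirected (hT : IsGluing T) {P : Type*} [Preorder P]
    [IsDirectedOrder P] (S : P ⥤ LowerSet Λ)
    {S' : LowerSet Λ} (hS : ∀ i, S.obj i ≤ S') (hS' : ∀ c ∈ S', ∃ i, c ∈ S.obj i)
    (c : Cocone (S ⋙ T)) (e : c.pt ≅ T.obj S')
    (hc : ∀ i, c.ι.app i ≫ e.hom = T.map (homOfLE (hS i))) :
    IsColimit c := by
  have H (c' : Cocone (S ⋙ T)) := hT.exists_desc_of_cover S.obj hS hS' (fun i => c'.ι.app i) (by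
    intro i j q hi hj
    obtain ⟨k, hik, hjk⟩ := exists_ge_ge i j
    have w₁ : T.map (S.map (homOfLE hik)) ≫ c'.ι.app k = c'.ι.app i := c'.w (homOfLE hik)
    have w₂ : T.map (S.map (homOfLE hjk)) ≫ c'.ι.app k = c'.ι.app j := c'.w (homOfLE hjk)
    refine (congrArg (_ ≫ ·) w₁.symm).trans (Eq.trans ?_ (congrArg (_ ≫ ·) w₂))
    rw [← assoc, ← assoc, ← T.map_comp, ← T.map_comp]
    rfl)
  have hc' (i) : c.ι.app i = T.map (homOfLE (hS i)) ≫ e.inv := by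
    rw [← hc, assoc, e.hom_inv_id]
    exact (comp_id _).symm
  exact
    { desc := fun c' => e.hom ≫ (H c').choose
      fac := fun c' i => by
        refine Eq.trans ?_ ((H c').choose_spec i)
        rw [← assoc, hc]
      uniq := fun c' m hm => by
        rw [← Iso.inv_comp_eq]
        refine hT.hom_ext_of_cover S.obj hS hS' _ _ fun i => ?_
        refine Eq.trans ?_ ((H c').choose_spec i).symm
        refine Eq.trans ?_ (hm i)
        rw [hc', assoc] }

end IsGluing

end Gluing

section OfCells

variable {Λ : Type v} {a b : Λ → K} {s : ∀ c, a c ⟶ b c} {att : ∀ c, Attach b (a c)}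

/-- The order on the cells of a cell system. -/
abbrev cellOrder (hv : ∀ c, IsValidAt s att c) (wf : WellFounded fun q c => q ∈ (att c).U) :
    PartialOrder Λ where
  le q c := q = c ∨ q ∈ (att c).U
  lt q c := q ∈ (att c).U
  le_refl q := Or.inl rfl
  le_trans q q' q'' h h' := by
    obtain rfl | h := h
    · exact h'
    · obtain rfl | h' := h'
      · exact Or.inr h
      · exact Or.inr ((hv q'').sol.isClosedUnder _ h' _ h)
  lt_iff_le_not_ge q c := by
    refine ⟨fun h => ⟨Or.inr h, ?_⟩, ?_⟩
    · rintro (rfl | h')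
      · exact wf.irrefl.1 _ h
      · exact wf.asymmetric _ _ h h'
    · rintro ⟨rfl | h, h'⟩
      · exact (h' (Or.inl rfl)).elim
      · exact h
  le_antisymm q q' h h' := by
    obtain rfl | h := h
    · rfl
    · obtain rfl | h' := h'
      · rfl
      · exact (wf.asymmetric _ _ h h').elim

lemma isPushout_of_isCorep {S S' : Set Λ} {T T' : K} {x : ∀ q ∈ S, (b q ⟶ T)}
    {x' : ∀ q ∈ S', (b q ⟶ T')} (h : IsCorep s att S T x) (h' : IsCorep s att S' T' x')
    (hsub : ∀ q ∈ S, q ∈ S') (c : Λ) (hcS : c ∉ S) (hc : c ∈ S') (hS' : ∀ q ∈ S', q = c ∨ q ∈ S)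
    (hv : IsValidAt s att c) (hU : ∀ q ∈ (att c).U, q ∈ S) :
    ∃ (u : a c ⟶ T) (v : b c ⟶ T'), IsPushout u (s c) (h.map h' hsub) v := by
  classical
  obtain ⟨m, hm⟩ := hv.exists_desc _ (h.sol.restrict hU hv.sol.isClosedUnder)
  obtain ⟨hU', l, h₁, h₂⟩ := h'.sol c hc
  have hl : l = m ≫ h.map h' hsub := hv.hom_ext _ _ fun q hq => by
    rw [h₁, ← assoc, hm, h.fac_map]
  have H (t : PushoutCocone ((att c).φ ≫ m) (s c)) :
      ∃ l : T' ⟶ t.pt, h.map h' hsub ≫ l = t.inl ∧ x' c hc ≫ l = t.inr := by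
    let y : ∀ q ∈ S', (b q ⟶ t.pt) := fun q hq =>
      if hqc : q = c then eqToHom (by rw [hqc]) ≫ t.inr
      else x q ((hS' q hq).resolve_left hqc) ≫ t.inl
    have hyc : y c hc = t.inr := by simp [y]
    have hyS : ∀ q (hq : q ∈ S), y q (hsub q hq) = x q hq ≫ t.inl := fun q hq =>
      dif_neg fun hqc : q = c => hcS (hqc ▸ hq)
    obtain ⟨l, hl⟩ := h'.exists_desc y (by
      intro c' hc'
      obtain rfl | hc'S := hS' c' hc'
      · refine ⟨hU', m ≫ t.inl, fun q hq => ?_, ?_⟩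
        · rw [hyS q (hU q hq), ← assoc, hm]
        · rw [hyc, ← assoc]
          exact t.condition.symm
      · obtain ⟨hV, k, h₃, h₄⟩ := h.sol.comp t.inl c' hc'S
        exact ⟨fun q hq => hsub q (hV q hq), k, fun q hq => (h₃ q hq).trans (hyS q _).symm,
          (congrArg (s c' ≫ ·) (hyS c' hc'S)).trans h₄⟩)
    refine ⟨l, h.hom_ext _ _ fun q hq => ?_, (hl c hc).trans hyc⟩
    rw [h.fac_map_assoc, hl, hyS]
  refine ⟨(att c).φ ≫ m, x' c hc, ⟨by rw [h₂, hl, assoc]⟩,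
    ⟨PushoutCocone.IsColimit.mk _ (fun t => (H t).choose) (fun t => (H t).choose_spec.1)
      (fun t => (H t).choose_spec.2) fun t k hk₁ hk₂ => h'.hom_ext _ _ fun q hq => ?_⟩⟩
  obtain rfl | hqS := hS' q hq
  · rw [hk₂, (H t).choose_spec.2]
  · have := x q hqS ≫= (hk₁.trans (H t).choose_spec.1.symm)
    rwa [h.fac_map_assoc, h.fac_map_assoc] at this

variable [PartialOrder Λ]

lemma isClosedUnder_of_lowerSet (hlt : ∀ q c, q ∈ (att c).U ↔ q < c) (S : LowerSet Λ) :
    IsClosedUnder att (S : Set Λ) :=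
  fun _ hc _ hq => S.lower ((hlt _ _).1 hq).le hc

lemma isGluing_corepFunctor {F : LowerSet Λ → K}
    {x : ∀ S : LowerSet Λ, ∀ q ∈ (S : Set Λ), b q ⟶ F S}
    (h : ∀ S : LowerSet Λ, IsCorep s att (S : Set Λ) (F S) (x S)) :
    IsGluing (corepFunctor (fun S : LowerSet Λ => (S : Set Λ)) h (fun _ _ h _ hq => h hq)) where
  exists_desc S W f hf := by
    obtain ⟨l, hl⟩ := exists_desc_of_cover (fun c : S => ((LowerSet.Iic c.1 : LowerSet Λ) : Set Λ))
      (fun c => h (LowerSet.Iic c.1)) (h S)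
      (fun c q hq => S.lower hq c.2) (fun q hq => ⟨⟨q, hq⟩, le_refl q⟩)
      (fun c => f c.1 c.2) (fun c c' q hq hq' => by
        have := x (LowerSet.Iic q) q (le_refl q) ≫=
          ((hf c.1 q c.2 hq).trans (hf c'.1 q c'.2 hq').symm)
        refine Eq.trans ?_ (this.trans ?_)
        · exact ((h (LowerSet.Iic q)).fac_map_assoc (h (LowerSet.Iic c.1))
            (fun _ h => le_trans h hq) q (le_refl q) (f c.1 c.2)).symm
        · exact (h (LowerSet.Iic q)).fac_map_assoc (h (LowerSet.Iic c'.1))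
            (fun _ h => le_trans h hq') q (le_refl q) (f c'.1 c'.2))
    exact ⟨l, fun c hc => hl ⟨c, hc⟩⟩
  hom_ext S W l l' hl :=
    hom_ext_of_cover (fun c : S => ((LowerSet.Iic c.1 : LowerSet Λ) : Set Λ))
      (fun c => h (LowerSet.Iic c.1)) (h S)
      (fun c q hq => S.lower hq c.2) (fun q hq => ⟨⟨q, hq⟩, le_refl q⟩) l l' fun c => hl c.1 c.2

variable [HasColimits K]

lemma isCorep_lowerSet (hlt : ∀ q c, q ∈ (att c).U ↔ q < c) (hv : ∀ c, IsValidAt s att c)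
    (S : LowerSet Λ) : IsCorep s att (S : Set Λ)
    (corepObj s att (S : Set Λ) (isClosedUnder_of_lowerSet hlt S))
    (fun q hq => generatorInl att S q hq ≫ corepπ s att S (isClosedUnder_of_lowerSet hlt S)) :=
  isCorep_corepObj s att (S : Set Λ) (isClosedUnder_of_lowerSet hlt S) fun c _ => hv c

variable (hlt : ∀ q c, q ∈ (att c).U ↔ q < c) (hv : ∀ c, IsValidAt s att c)

/-- The functor on lower sets corresponding to a cell system. -/
noncomputable abbrev cellFunctor : LowerSet Λ ⥤ K :=
  corepFunctor (fun S : LowerSet Λ => (S : Set Λ)) (isCorep_lowerSet hlt hv)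
    (fun _ _ h _ hq => h hq)

lemma isGluing_cellFunctor : IsGluing (cellFunctor hlt hv) :=
  isGluing_corepFunctor (isCorep_lowerSet hlt hv)

lemma isPushout_cellFunctor (c : Λ) {S S' : LowerSet Λ} (h : S ≤ S') (hS : c ∉ S)
    (hc : c ∈ S') (hcS : ∀ q ∈ S', q = c ∨ q ∈ S) :
    ∃ (u : a c ⟶ (cellFunctor hlt hv).obj S) (v : b c ⟶ (cellFunctor hlt hv).obj S'),
      IsPushout u (s c) ((cellFunctor hlt hv).map (homOfLE h)) v :=
  isPushout_of_isCorep (isCorep_lowerSet hlt hv S) (isCorep_lowerSet hlt hv S') (fun _ hq => h hq) c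
    hS hc hcS (hv c) fun q hq =>
      ((hcS q (S'.lower ((hlt _ _).1 hq).le hc)).resolve_left ((hlt _ _).1 hq).ne)

end OfCells

section SmallObjectArgument

variable (κ : Cardinal.{v}) [Fact κ.IsRegular]

lemma nonempty_orderBot_ord_toType : Nonempty (OrderBot κ.ord.ToType) := by
  have : Nonempty κ.ord.ToType := by
    rw [Ordinal.nonempty_toType_iff, ne_eq, Cardinal.ord_eq_zero]
    exact (Fact.out : κ.IsRegular).ne_zero
  exact ⟨WellFoundedLT.toOrderBot _⟩

lemma isCardinalForSmallObjectArgument [OrderBot κ.ord.ToType] [HasColimits K]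
    (I : MorphismProperty K) [MorphismProperty.IsSmall.{v} I]
    (hI : ∀ ⦃A B : K⦄ (i : A ⟶ B), I i → CategoryTheory.IsCardinalPresentable A κ) :
    I.IsCardinalForSmallObjectArgument κ where
  preservesColimit {A _ _ _} i hi _ hf := by
    have := hI i hi
    have := preservesColimitsOfShape_of_isCardinalPresentable A κ κ.ord.ToType
    infer_instance

lemma IsCorep.of_iso {Λ : Type v} {a b : Λ → K} {s : ∀ c, a c ⟶ b c} {att : ∀ c, Attach b (a c)}
    {S : Set Λ} {T T' : K} {x : ∀ q ∈ S, (b q ⟶ T)} (h : IsCorep s att S T x) (e : T ≅ T') :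
    IsCorep s att S T' fun q hq => x q hq ≫ e.hom where
  sol := h.sol.comp e.hom
  exists_desc y hy := by
    obtain ⟨l, hl⟩ := h.exists_desc y hy
    exact ⟨e.inv ≫ l, fun q hq => by simp [hl]⟩
  hom_ext l l' hl := by
    rw [← cancel_epi e.hom]
    exact h.hom_ext _ _ fun q hq => by simpa using hl q hq

lemma IsCorep.congr_set {Λ : Type v} {a b : Λ → K} {s : ∀ c, a c ⟶ b c}
    {att : ∀ c, Attach b (a c)} {S S' : Set Λ} {T : K} {x : ∀ q ∈ S, (b q ⟶ T)}
    (h : IsCorep s att S T x) (hS : ∀ q, q ∈ S ↔ q ∈ S') :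
    IsCorep s att S' T fun q hq => x q ((hS q).2 hq) := by
  obtain rfl : S = S' := Set.ext hS
  exact h

/-- The isomorphism between two corepresenting objects. -/
noncomputable def IsCorep.iso {Λ : Type v} {a b : Λ → K} {s : ∀ c, a c ⟶ b c}
    {att : ∀ c, Attach b (a c)}
    {S S' : Set Λ} {T T' : K} {x : ∀ q ∈ S, (b q ⟶ T)} {x' : ∀ q ∈ S', (b q ⟶ T')}
    (h : IsCorep s att S T x) (h' : IsCorep s att S' T' x') (hS : ∀ q ∈ S, q ∈ S')
    (hS' : ∀ q ∈ S', q ∈ S) : T ≅ T' where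
  hom := h.map h' hS
  inv := h'.map h hS'
  hom_inv_id := (h.map_map h' h _ _).trans h.map_self
  inv_hom_id := (h'.map_map h h' _ _).trans h'.map_self

/-- The initial maps and codiagonals of the objects satisfying `P`. -/
def generatorMaps [HasColimits K] (P : ObjectProperty K) : MorphismProperty K :=
  MorphismProperty.ofHoms (fun G : Subtype P => initial.to G.1) ⊔
    MorphismProperty.ofHoms (fun G : Subtype P => coprod.desc (𝟙 G.1) (𝟙 G.1))

instance isSmall_sup (I J : MorphismProperty K) [MorphismProperty.IsSmall.{w} I]
    [MorphismProperty.IsSmall.{w} J] : MorphismProperty.IsSmall.{w} (I ⊔ J) where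
  small_toSet := (small_union I.toSet J.toSet :)

variable {I : MorphismProperty K}

section

variable [HasColimits K] (P : ObjectProperty K)

instance [ObjectProperty.Small.{v} P] : MorphismProperty.IsSmall.{v} (generatorMaps P) := by
  have : Small.{v} (Subtype P) := inferInstanceAs (ObjectProperty.Small.{v} P)
  exact inferInstanceAs (MorphismProperty.IsSmall (_ ⊔ _))

lemma isIso_of_rlp_generatorMaps (hP : P.IsStrongGenerator) {X Y : K} (p : X ⟶ Y)
    (hp : (generatorMaps P).rlp p) : IsIso p := by
  rw [ObjectProperty.isStrongGenerator_iff] at hP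
  have : Mono p := (hP.1.mono_iff p).2 fun G hG g₁ g₂ h => by
    have := hp _ (Or.inr (MorphismProperty.ofHoms.mk (⟨G, hG⟩ : Subtype P)))
    have sq : CommSq (coprod.desc g₁ g₂) (coprod.desc (𝟙 G) (𝟙 G)) p (g₁ ≫ p) :=
      ⟨by
        ext
        · simp [coprod.inl_desc]
        · simp [coprod.inr_desc, h]⟩
    have h₁ := coprod.inl ≫= sq.fac_left
    have h₂ := coprod.inr ≫= sq.fac_left
    simp only [coprod.inl_desc_assoc, coprod.inr_desc_assoc, coprod.inl_desc, coprod.inr_desc]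
      at h₁ h₂
    exact h₁.symm.trans h₂
  refine hP.2 p fun G hG g => ?_
  have := hp _ (Or.inl (MorphismProperty.ofHoms.mk (⟨G, hG⟩ : Subtype P)))
  have sq : CommSq (initial.to X) (initial.to G) p g := ⟨by ext⟩
  exact ⟨sq.lift, sq.fac_right⟩

lemma isCardinalPresentable_of_generatorMaps (hP : P ≤ isCardinalPresentable K κ) ⦃A B : K⦄
    (i : A ⟶ B) (hi : generatorMaps P i) :
    CategoryTheory.IsCardinalPresentable A κ ∧ CategoryTheory.IsCardinalPresentable B κ := by
  obtain ⟨⟨G, hG⟩⟩ | ⟨⟨G, hG⟩⟩ := hi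
  · have (i : Discrete PEmpty.{1}) :
        CategoryTheory.IsCardinalPresentable ((Functor.empty.{0} K).obj i) κ := i.as.elim
    exact ⟨isCardinalPresentable_of_isColimit _ (colimit.isColimit (Functor.empty.{0} K)) κ
      (hasCardinalLT_of_finite _ κ (Fact.out : κ.IsRegular).aleph0_le), hP _ hG⟩
  · have : CategoryTheory.IsCardinalPresentable G κ := hP _ hG
    exact ⟨isCardinalPresentable_coprod κ _ _, this⟩

/-- A functor on the lower sets of a set of cells, describing the gluing of a complex with
`κ`-small cells, such that the cells outside of `A` are pushouts of morphisms in `I`. -/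
structure IsCellLattice (κ : Cardinal.{v}) [Fact κ.IsRegular] (I : MorphismProperty K)
    {Λ : Type v} [PartialOrder Λ] (T : LowerSet Λ ⥤ K) (A : LowerSet Λ) : Prop where
  gluing : IsGluing T
  card : ∀ c : Λ, HasCardinalLT (LowerSet.Iic c) κ
  presentable : ∀ S : LowerSet Λ, HasCardinalLT S κ →
    CategoryTheory.IsCardinalPresentable (T.obj S) κ
  pushouts : ∀ c ∉ A, ∀ {S S' : LowerSet Λ} (h : S ≤ S'), c ∉ S → c ∈ S' →
    (∀ q ∈ S', q = c ∨ q ∈ S) → I.pushouts (T.map (homOfLE h))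

/-- `X` is a complex with cells in `I`. -/
def HasCells (I : MorphismProperty K) (X : K) : Prop :=
  ∃ (Λ : Type v) (a b : Λ → K) (s : ∀ c, a c ⟶ b c) (att : ∀ c, Attach b (a c))
    (x : ∀ q, b q ⟶ X), (∀ q, I (s q)) ∧ (∀ q, IsValidAt s att q) ∧
      (WellFounded fun q c => q ∈ (att c).U) ∧ IsCorep s att Set.univ X (fun q _ => x q)

lemma hasCells_of_isStrongGenerator [ObjectProperty.Small.{v} P] (hP : P.IsStrongGenerator)
    (hP' : P ≤ isCardinalPresentable K κ) (X : K) : HasCells (generatorMaps P) X := by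
  obtain ⟨_⟩ := nonempty_orderBot_ord_toType κ
  have := isCardinalForSmallObjectArgument κ (generatorMaps P)
    (fun _ _ i hi => (isCardinalPresentable_of_generatorMaps κ P hP' i hi).1)
  let f := initial.to X
  have := isIso_of_rlp_generatorMaps P hP _ (SmallObject.rlp_πObj (generatorMaps P) κ f)
  let c := SmallObject.relativeCellComplexιObj (generatorMaps P) κ f
  let a₁ : PEmpty.{v + 1} → K := fun q => q.elim
  let s₁ : ∀ q, a₁ q ⟶ a₁ q := fun q => q.elim
  let att₁ : ∀ q, Attach a₁ (a₁ q) := fun q => q.elim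
  let x₁ : ∀ q, a₁ q ⟶ ⊥_ K := fun q => q.elim
  have h₁ : IsCorep s₁ att₁ Set.univ (⊥_ K) fun q _ => x₁ q :=
    ⟨fun q => q.elim, fun _ _ => ⟨initial.to _, fun q => q.elim⟩, fun _ _ _ => by ext⟩
  refine ⟨_, _, _, extS c s₁, extAtt att₁ x₁ c, fun z => extTop c x₁ z ?_ ≫
    SmallObject.πObj (generatorMaps P) κ f, ?_, isValidAt_extAtt c (fun q => q.elim) h₁,
    wellFounded_extAtt att₁ x₁ c ⟨fun q => q.elim⟩, ?_⟩
  · obtain ⟨⟨⟩⟩ | z := z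
    trivial
  · rintro (⟨⟨⟩⟩ | z)
    exact (cellIdx c z).2
  · let π := asIso (SmallObject.πObj (generatorMaps P) κ f)
    refine ((isCorep_extTop c h₁).of_iso π).congr_set ?_
    rintro (⟨⟨⟩⟩ | z)
    simp

end

lemma retract_of_comm_iso {X Y Z W A : K} {i : X ⟶ Z} {f : X ⟶ Y} {p : Z ⟶ Y} {l : Y ⟶ Z}
    (hi : i ≫ p = f) (hl : f ≫ l = i) (hp : l ≫ p = 𝟙 Y) (e : X ≅ A) (e' : Z ≅ W) {m : A ⟶ W}
    (hm : e.hom ≫ m = i ≫ e'.hom) :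
    (l ≫ e'.hom) ≫ e'.inv ≫ p = 𝟙 Y ∧ e.hom ≫ m ≫ e'.inv ≫ p = f ∧
      f ≫ l ≫ e'.hom = e.hom ≫ m :=
  ⟨by simp [hp], by rw [reassoc_of% hm]; simp [hi], by rw [reassoc_of% hl, hm]⟩

theorem exists_isCellLattice [IsCardinalLocallyPresentable K κ] [MorphismProperty.IsSmall.{v} I]
    (hI : ∀ ⦃A B : K⦄ (i : A ⟶ B), I i → CategoryTheory.IsCardinalPresentable A κ ∧
      CategoryTheory.IsCardinalPresentable B κ) {X Y : K} (f : X ⟶ Y) (hf : I.rlp.llp f) :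
    ∃ (Λ : Type v) (_ : PartialOrder Λ) (_ : WellFoundedLT Λ) (T : LowerSet Λ ⥤ K)
      (A : LowerSet Λ) (_ : IsCellLattice κ I T A) (e : X ≅ T.obj A) (p : T.obj ⊤ ⟶ Y)
      (t : Y ⟶ T.obj ⊤), t ≫ p = 𝟙 Y ∧ e.hom ≫ T.map (homOfLE le_top) ≫ p = f ∧
        f ≫ t = e.hom ≫ T.map (homOfLE le_top) := by
  obtain ⟨P, _, hP, hP'⟩ := (IsCardinalLocallyPresentable.iff_exists_isStrongGenerator K κ).1
    inferInstance
  obtain ⟨Λ₁, a₁, b₁, s₁, att₁, x₁, hs₁, hv₁, wf₁, h₁⟩ := hasCells_of_isStrongGenerator κ P hP hP' X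
  obtain ⟨_⟩ := nonempty_orderBot_ord_toType κ
  have := isCardinalForSmallObjectArgument κ I (fun _ _ i hi => (hI i hi).1)
  let c := SmallObject.relativeCellComplexιObj I κ f
  let s := extS c s₁
  let att := extAtt att₁ x₁ c
  have hv : ∀ q, IsValidAt s att q := isValidAt_extAtt c hv₁ h₁
  have wf : WellFounded fun q c => q ∈ (att c).U := wellFounded_extAtt att₁ x₁ c wf₁
  have hs (q) : CategoryTheory.IsCardinalPresentable
        (sumFam a₁ (fun δ => (cellIdx c δ).1.left) q) κ ∧
      CategoryTheory.IsCardinalPresentable (sumFam b₁ (fun δ => (cellIdx c δ).1.right) q) κ := by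
    obtain q | q := q
    · exact isCardinalPresentable_of_generatorMaps κ P hP' _ (hs₁ q)
    · exact hI _ (cellIdx c q).2
  have ha := fun q => (hs q).1
  have hb := fun q => (hs q).2
  obtain ⟨att', hatt'⟩ := exists_isThinning (κ := κ) hv wf
  have hv' : ∀ q, IsValidAt s att' q := fun q => (hatt' q).isCorep
  have wf' : WellFounded fun q c => q ∈ (att' c).U :=
    Subrelation.wf (fun h => (hatt' _).subset _ h) wf
  have hX : IsCorep s att' (sumSet Set.univ ∅) X _ := isCorep_of_isThinning hv wf
    (h₁.inl c).sol.isClosedUnder (fun q _ => hatt' q) (h₁.inl c)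
  have hZ : IsCorep s att' (sumSet Set.univ Set.univ) _ _ := isCorep_of_isThinning hv wf
    (isCorep_extTop c h₁).sol.isClosedUnder (fun q _ => hatt' q) (isCorep_extTop c h₁)
  let ord := cellOrder hv' wf'
  have hlt (q c) : q ∈ (att' c).U ↔ q < c := Iff.rfl
  let A : LowerSet (Λ₁ ⊕ c.Cells) := ⟨sumSet Set.univ ∅, by
    rintro q q' (rfl | h) hq
    · exact hq
    · exact hX.sol.isClosedUnder _ hq _ h⟩
  have hA := isCorep_lowerSet hlt hv' A
  have hT := isCorep_lowerSet hlt hv' ⊤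
  let e := hX.iso hA (fun _ => id) (fun _ => id)
  let e' := hZ.iso hT (fun _ _ => trivial) (by rintro (q | q) <;> simp)
  have hee' : e.hom ≫ (cellFunctor hlt hv').map (homOfLE le_top) =
      SmallObject.ιObj I κ f ≫ e'.hom := by
    refine hX.hom_ext _ _ fun q hq => ?_
    have h₁ := (assoc _ _ _).symm.trans ((congrArg (· ≫ _) (hX.fac_map hA (fun _ => id) q hq)).trans
      (hA.fac_map hT (fun _ _ => trivial) q hq))
    obtain q | q := q
    · exact h₁.trans ((hZ.fac_map hT (fun _ _ => trivial) (Sum.inl q) trivial).symm.trans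
        (assoc _ _ _))
    · exact hq.elim
  have sq : CommSq (SmallObject.ιObj I κ f) f (SmallObject.πObj I κ f) (𝟙 Y) := ⟨by simp⟩
  have := hf _ (SmallObject.rlp_πObj I κ f)
  refine ⟨_, ord, ⟨wf'⟩, cellFunctor hlt hv', A, ⟨isGluing_cellFunctor hlt hv', ?_, ?_, ?_⟩, e,
    e'.inv ≫ SmallObject.πObj I κ f, sq.lift ≫ e'.hom,
    retract_of_comm_iso (by simp) sq.fac_left sq.fac_right e e' hee'⟩
  · intro z
    have : (LowerSet.Iic z : Set (Λ₁ ⊕ c.Cells)) = {z} ∪ (att' z).U := rfl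
    change HasCardinalLT (LowerSet.Iic z : Set (Λ₁ ⊕ c.Cells)) κ
    rw [this]
    exact hasCardinalLT_union (Fact.out : κ.IsRegular).aleph0_le
      (hasCardinalLT_of_finite _ κ (Fact.out : κ.IsRegular).aleph0_le) (hatt' z).card
  · exact fun S hS => isCardinalPresentable_corepObj s att' κ S _ hS (fun q _ => (hatt' q).card)
      fun q _ => (hatt' q).presentable
  · rintro (z | z) hzA S S' h hz hz' hS
    · exact (hzA (show (Sum.inl z : Λ₁ ⊕ c.Cells) ∈ sumSet Set.univ ∅ from trivial)).elim
    · obtain ⟨u, v, sq⟩ := isPushout_cellFunctor hlt hv' (Sum.inr z) h hz hz' hS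
      exact ⟨_, _, _, _, _, (cellIdx c z).2, sq⟩

end SmallObjectArgument

section Chain

variable {Λ : Type v} [PartialOrder Λ]

/-- The lower sets between `S` and `S'` determined by the initial segments of a linear order. -/
def chainLowerSet {W : Type*} [LinearOrder W] (S S' : LowerSet Λ)
    (φ : {c // c ∈ S' ∧ c ∉ S} → W) (hφ : StrictMono φ) (j : WithTop W) : LowerSet Λ where
  carrier := {c | c ∈ S ∨ ∃ h, (φ ⟨c, h⟩ : WithTop W) < j}
  lower' := by
    rintro c c' hc' (hc | ⟨h, hc⟩)
    · exact Or.inl (S.lower hc' hc)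
    · by_cases hS : c' ∈ S
      · exact Or.inl hS
      · refine Or.inr ⟨⟨S'.lower hc' h.1, hS⟩, lt_of_le_of_lt ?_ hc⟩
        exact WithTop.coe_le_coe.2 (hφ.monotone hc')

lemma chainLowerSet_mono {W : Type*} [LinearOrder W] (S S' : LowerSet Λ)
    (φ : {c // c ∈ S' ∧ c ∉ S} → W) (hφ : StrictMono φ) : Monotone (chainLowerSet S S' φ hφ) := by
  rintro j j' hj c (hc | ⟨h, hc⟩)
  · exact Or.inl hc
  · exact Or.inr ⟨h, hc.trans_le hj⟩

lemma IsGluing.isTransfiniteCompositionOf [WellFoundedLT Λ] {T : LowerSet Λ ⥤ K}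
    (hT : IsGluing T) (Q : MorphismProperty K) {S S' : LowerSet Λ} (hS : S ≤ S')
    (hQ : ∀ c ∈ S', c ∉ S → ∀ {R R' : LowerSet Λ} (h : R ≤ R'), c ∉ R → c ∈ R' →
      (∀ q ∈ R', q = c ∨ q ∈ R) → Q (T.map (homOfLE h))) :
    IsTransfiniteCompositionOf.{v} Q (T.map (homOfLE hS)) := by
  obtain ⟨W, _, _, φ, hφ, hφ'⟩ : ∃ (W : Type v) (_ : LinearOrder W) (_ : WellFoundedLT W)
      (φ : {c // c ∈ S' ∧ c ∉ S} → W), StrictMono φ ∧ Function.Bijective φ :=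
    ⟨WellOrderExtension {c // c ∈ S' ∧ c ∉ S}, inferInstance, inferInstance, toWellOrderExtension,
      toWellOrderExtension_strictMono, toWellOrderExtension.bijective⟩
  let bot : OrderBot (WithTop W) := WellFoundedLT.toOrderBot _
  let succ : SuccOrder (WithTop W) := SuccOrder.ofLinearWellFoundedLT _
  let m := chainLowerSet S S' φ hφ
  let F : WithTop W ⥤ K := (chainLowerSet_mono S S' φ hφ).functor ⋙ T
  have hbot : m ⊥ = S := by
    refine le_antisymm ?_ fun c hc => Or.inl hc
    rintro c (hc | ⟨h, hc⟩)
    · exact hc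
    · exact (not_lt_bot hc).elim
  have htop : m ⊤ = S' := by
    refine le_antisymm ?_ fun c hc => ?_
    · rintro c (hc | ⟨h, hc⟩)
      · exact hS hc
      · exact h.1
    · by_cases h : c ∈ S
      · exact Or.inl h
      · exact Or.inr ⟨⟨hc, h⟩, WithTop.coe_lt_top _⟩
  refine ⟨WithTop W, inferInstance, succ, bot, inferInstance, F,
    _, colimitOfDiagramTerminal isTerminalTop F, T.mapIso (eqToIso hbot.symm),
    T.mapIso (eqToIso htop), ?_, ?_, ?_⟩
  · intro j hj
    induction j using WithTop.recTopCoe with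
    | top => exact (hj isMax_top).elim
    | coe w =>
      obtain ⟨⟨c, hc⟩, rfl⟩ := hφ'.2 w
      refine hQ c hc.1 hc.2 (chainLowerSet_mono S S' φ hφ (Order.le_succ _)) ?_ ?_ ?_
      · rintro (h | ⟨h, hc⟩)
        · exact hc.2 h
        · exact lt_irrefl _ hc
      · exact Or.inr ⟨hc, Order.lt_succ_of_not_isMax hj⟩
      · rintro q (h | ⟨h, hq⟩)
        · exact Or.inr (Or.inl h)
        · obtain hq | hq := (Order.le_of_lt_succ hq).lt_or_eq
          · exact Or.inr (Or.inr ⟨h, hq⟩)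
          · exact Or.inl (congrArg Subtype.val (hφ'.1 (WithTop.coe_injective hq)))
  · intro j hj
    have : Nonempty {i // i < j} := ⟨⟨⊥, hj.bot_lt⟩⟩
    let G : {i // i < j} ⥤ LowerSet Λ :=
      Monotone.functor (f := fun i : {i // i < j} => m i) fun _ _ h =>
        chainLowerSet_mono S S' φ hφ h
    refine ⟨hT.isColimitOfDirected G (S' := m j) (fun i => chainLowerSet_mono S S' φ hφ i.2.le) ?_
      (coconeLT F j) (Iso.refl _) fun i => comp_id _⟩
    rintro c (hc | ⟨h, hc⟩)
    · exact ⟨⟨⊥, hj.bot_lt⟩, Or.inl hc⟩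
    · exact ⟨⟨_, hj.succ_lt hc⟩, Or.inr ⟨h, Order.lt_succ_of_not_isMax (not_isMax_of_lt hc)⟩⟩
  · change T.map _ ≫ T.map _ ≫ T.map _ = _
    rw [← T.map_comp, ← T.map_comp]
    rfl

end Chain

section Closure

lemma IsCellLattice.isTransfiniteCompositionOf {κ : Cardinal.{v}} [Fact κ.IsRegular]
    {I : MorphismProperty K} {Λ : Type v} [PartialOrder Λ] [WellFoundedLT Λ]
    {T : LowerSet Λ ⥤ K} {A : LowerSet Λ} (hT : IsCellLattice κ I T A) {S S' : LowerSet Λ}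
    (hA : S' ⊓ A ≤ S) (hS : S ≤ S') :
    IsTransfiniteCompositionOf.{v} (Po I) (T.map (homOfLE hS)) :=
  hT.gluing.isTransfiniteCompositionOf _ hS fun c hc' hc _ _ h h₁ h₂ h₃ => by
    obtain ⟨_, _, u, s, v, hs, sq⟩ := hT.pushouts c (fun h => hc (hA ⟨hc', h⟩)) h h₁ h₂ h₃
    exact ⟨_, _, _, _, _, hs, sq.flip⟩

lemma le_Po (X : MorphismProperty K) : X ≤ Po X := fun _ _ f hf =>
  ⟨_, _, f, 𝟙 _, 𝟙 _, hf, IsPushout.of_vert_isIso ⟨by simp⟩⟩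

lemma Po_le {C X : MorphismProperty K} (hC : IsCellular C) (h : X ≤ C) : Po X ≤ C := by
  rintro _ _ g ⟨_, _, f, _, _, hf, sq⟩
  exact hC.pushout sq (h _ hf)

lemma IsTransfiniteCompositionOf.mono {C C' : MorphismProperty K} (h : C ≤ C') :
    IsTransfiniteCompositionOf.{w} C ≤ IsTransfiniteCompositionOf.{w} C' := by
  rintro _ _ _ ⟨J, _, _, _, _, F, c, hc, eA, eB, h₁, h₂⟩
  exact ⟨J, _, _, _, ‹_›, F, c, hc, eA, eB, fun j hj => h _ (h₁ j hj), h₂⟩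

lemma cofClosure_le {C X : MorphismProperty K} (hC : IsCellular C) (hC' : retracts C ≤ C)
    (h : X ≤ C) : cofClosure X ≤ C := by
  rintro _ _ f ⟨_, _, g, hg, hfg⟩
  exact hC' _ ⟨_, _, g, hC.transfinite _ (IsTransfiniteCompositionOf.mono (Po_le hC h) _ hg), hfg⟩

/-- The generators of `cofClosure X` belong to it. -/
lemma le_cofClosure (X : MorphismProperty K) : X ≤ cofClosure X := by
  intro A B f hf
  let succ : SuccOrder (ULift.{v} (Fin 2)) := SuccOrder.ofLinearWellFoundedLT _
  let m : ULift.{v} (Fin 2) ⥤ Fin 2 := Monotone.functor (f := ULift.down) fun _ _ h => h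
  let F := m ⋙ ComposableArrows.mk₁ f
  have h₀ (j : ULift.{v} (Fin 2)) (hj : ¬ IsMax j) : j = ⟨0⟩ := by
    obtain ⟨j⟩ := j
    match j with
    | 0 => rfl
    | 1 => exact (hj isMax_top).elim
  refine ⟨A, B, f, ⟨ULift.{v} (Fin 2), inferInstance, succ, inferInstance, inferInstance, F,
    _, colimitOfDiagramTerminal isTerminalTop F, Iso.refl _,
    Iso.refl _, ?_, ?_, ?_⟩, 𝟙 _, 𝟙 _, 𝟙 _, 𝟙 _, by simp, by simp, by simp, by simp⟩
  · intro j hj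
    obtain rfl := h₀ j hj
    have h₁ := Order.lt_succ_of_not_isMax hj
    have h₂ : Order.succ (⟨0⟩ : ULift.{v} (Fin 2)) = ⟨1⟩ := by
      by_contra h
      exact h₁.ne' (h₀ _ fun h' => h (le_antisymm le_top (h' le_top)))
    have h₃ (k : ULift.{v} (Fin 2)) (hk : ⟨0⟩ ≤ k) (h : k = ⟨1⟩) :
        Po X (F.map (homOfLE hk)) := by
      subst h
      exact le_Po X f hf
    exact h₃ _ _ h₂
  · intro j hj
    obtain ⟨j⟩ := j
    match j with
    | 0 => exact (hj.1 isMin_bot).elim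
    | 1 => exact (hj.2 ⟨0⟩ ⟨by decide, fun k h h' => by
        obtain ⟨k⟩ := k
        match k with
        | 0 => exact lt_irrefl _ h
        | 1 => exact lt_irrefl _ h'⟩).elim
  · exact (id_comp _).trans (comp_id _)

lemma isCellular_llp (X : MorphismProperty K) : IsCellular X.llp where
  isos f _ := MorphismProperty.of_isIso _ f
  pushout sq h := MorphismProperty.of_isPushout sq.flip h
  transfinite := by
    rintro A B _ ⟨J, _, _, _, _, F, c, hc, eA, eB, h₁, h₂, rfl⟩ X Y p hp
    have : F.IsWellOrderContinuous := ⟨h₂⟩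
    have : HasLiftingProperty (c.ι.app ⊥) p :=
      HasLiftingProperty.transfiniteComposition.hasLiftingProperty_ι_app_bot hc
        fun j hj => h₁ j hj p hp
    infer_instance

lemma retracts_llp_le (X : MorphismProperty K) : retracts X.llp ≤ X.llp := by
  rintro _ _ f ⟨_, _, g, hg, u, v, r, s, h₁, h₂, h₃, h₄⟩
  exact MorphismProperty.of_retract (f := f) (g := g)
    { i := Arrow.homMk u v h₁, r := Arrow.homMk r s h₂ } hg

lemma llp_rlp_le_cofClosure {κ : Cardinal.{v}} [Fact κ.IsRegular]
    [IsCardinalLocallyPresentable K κ] {I : MorphismProperty K} [MorphismProperty.IsSmall.{v} I]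
    (hI : ∀ ⦃A B : K⦄ (i : A ⟶ B), I i → CategoryTheory.IsCardinalPresentable A κ ∧
      CategoryTheory.IsCardinalPresentable B κ) : I.rlp.llp ≤ cofClosure I := by
  intro X Y f hf
  obtain ⟨Λ, _, _, T, A, hT, e, p, t, h₁, h₂, h₃⟩ := exists_isCellLattice κ hI f hf
  refine ⟨_, _, _, hT.isTransfiniteCompositionOf inf_le_right le_top, e.hom, t, e.inv, p,
    ?_, ?_, ?_, h₁⟩
  · exact h₃.symm
  · rw [← h₂]; simp
  · simp

end Closure

section Semifunctor

variable {D : Type*} [Category D]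

/-- A semifunctor: it preserves composition, but not necessarily identities. -/
structure Semifunctor (M : D → K) where
  map : ∀ {d d' : D}, (d ⟶ d') → (M d ⟶ M d')
  map_comp : ∀ {d d' d'' : D} (α : d ⟶ d') (β : d' ⟶ d''), map (α ≫ β) = map α ≫ map β

/-- The approximation of a semifunctor on the colimit of `V` by maps between terms of `V`. -/
structure Approximation {P : Type*} [Preorder P] (V : D → P ⥤ K) {M : D → K}
    (j : ∀ d p, (V d).obj p ⟶ M d) (z : Semifunctor M) (p : P) where
  next : P
  le : p ≤ next
  hom : ∀ {d d' : D}, (d ⟶ d') → ((V d).obj p ⟶ (V d').obj next)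
  hom_comp : ∀ {d d' : D} (α : d ⟶ d'), hom α ≫ j d' next = j d p ≫ z.map α

variable {P : Type v} [Preorder P]

lemma exists_forall_forall_le {κ : Cardinal.{v}} (hP : ∀ {ι : Type v}, HasCardinalLT ι κ →
    ∀ s : ι → P, ∃ p, ∀ i, s i ≤ p) {ι : Type v} (hι : HasCardinalLT ι κ) {Q : ι → P → Prop}
    (h : ∀ i, ∃ p, ∀ q, p ≤ q → Q i q) : ∃ p, ∀ q, p ≤ q → ∀ i, Q i q := by
  choose s hs using h
  obtain ⟨p, hp⟩ := hP hι s
  exact ⟨p, fun q hq i => hs i q ((hp i).trans hq)⟩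

end Semifunctor

section Semifunctor

variable {D : Type v} [SmallCategory D] {P : Type v} [Preorder P]

lemma Approximation.exists {κ : Cardinal.{v}} (hκ : Cardinal.aleph0 ≤ κ)
    (hP : ∀ {ι : Type v}, HasCardinalLT ι κ →
    ∀ s : ι → P, ∃ p, ∀ i, s i ≤ p) (hD : HasCardinalLT D κ)
    (hD' : ∀ d d' : D, HasCardinalLT (d ⟶ d') κ) {V : D → P ⥤ K} {M : D → K}
    {j : ∀ d p, (V d).obj p ⟶ M d} (hj : ∀ d p p' (h : p ≤ p'), (V d).map (homOfLE h) ≫ j d p' =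
      j d p)
    (hV : ∀ d d' p (f : (V d).obj p ⟶ M d'), ∃ p' f', f' ≫ j d' p' = f)
    (z : Semifunctor M) (p : P) : Nonempty (Approximation V j z p) := by
  have H : ∃ p', ∀ q, p' ≤ q → ∀ d d' (α : d ⟶ d'), ∃ f : (V d).obj p ⟶ (V d').obj q,
      f ≫ j d' q = j d p ≫ z.map α := by
    refine exists_forall_forall_le hP hD fun d => exists_forall_forall_le hP hD fun d' =>
      exists_forall_forall_le hP (hD' d d') fun α => ?_
    obtain ⟨p', f', hf'⟩ := hV d d' p (j d p ≫ z.map α)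
    exact ⟨p', fun q hq => ⟨f' ≫ (V d').map (homOfLE hq), by rw [assoc, hj, hf']⟩⟩
  obtain ⟨p', hp'⟩ := H
  obtain ⟨q, hq⟩ := hP (hasCardinalLT_of_finite (ULift.{v} Bool) κ hκ)
    fun b => if b.down then p else p'
  have := hp' q (hq ⟨false⟩)
  choose f hf using this
  exact ⟨⟨q, hq ⟨true⟩, fun α => f _ _ α, hf _ _⟩⟩

lemma Approximation.exists_next {κ : Cardinal.{v}} (hκ : Cardinal.aleph0 ≤ κ)
    (hP : ∀ {ι : Type v}, HasCardinalLT ι κ →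
    ∀ s : ι → P, ∃ p, ∀ i, s i ≤ p) (hD : HasCardinalLT D κ)
    (hD' : ∀ d d' : D, HasCardinalLT (d ⟶ d') κ) {V : D → P ⥤ K} {M : D → K}
    {j : ∀ d p, (V d).obj p ⟶ M d} (hj : ∀ d p p' (h : p ≤ p'), (V d).map (homOfLE h) ≫ j d p' =
      j d p)
    (hV : ∀ d d' p (f : (V d).obj p ⟶ M d'), ∃ p' f', f' ≫ j d' p' = f)
    (hV' : ∀ d d' p p' (f f' : (V d).obj p ⟶ (V d').obj p'), f ≫ j d' p' = f' ≫ j d' p' →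
      ∃ p'', ∃ h : p' ≤ p'', f ≫ (V d').map (homOfLE h) = f' ≫ (V d').map (homOfLE h))
    {z : Semifunctor M} {p : P} (a : Approximation V j z p) :
    ∃ a' : Approximation V j z a.next,
      (∀ {d d' : D} (α : d ⟶ d'), (V d).map (homOfLE a.le) ≫ a'.hom α =
        a.hom α ≫ (V d').map (homOfLE a'.le)) ∧
      ∀ {d d' d'' : D} (α : d ⟶ d') (β : d' ⟶ d''), a.hom α ≫ a'.hom β =
        a.hom (α ≫ β) ≫ (V d'').map (homOfLE a'.le) := by
  obtain ⟨b⟩ := Approximation.exists hκ hP hD hD' hj hV z a.next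
  have H {d d' : D} {p p' : P} (f f' : (V d).obj p ⟶ (V d').obj p')
      (h : f ≫ j d' p' = f' ≫ j d' p') : ∃ p'', ∀ q, p'' ≤ q → ∀ hq : p' ≤ q,
        f ≫ (V d').map (homOfLE hq) = f' ≫ (V d').map (homOfLE hq) := by
    obtain ⟨p'', h, w⟩ := hV' d d' p p' f f' h
    refine ⟨p'', fun q hq hq' => ?_⟩
    rw [← map_homOfLE_comp (V d') h hq, reassoc_of% w]
  obtain ⟨p₁, hp₁⟩ := exists_forall_forall_le hP hD fun d => exists_forall_forall_le hP hD
    fun d' => exists_forall_forall_le hP (hD' d d') fun α =>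
      H ((V d).map (homOfLE a.le) ≫ b.hom α) (a.hom α ≫ (V d').map (homOfLE b.le)) (by
        rw [assoc, assoc, hj, a.hom_comp, b.hom_comp, ← assoc, hj])
  obtain ⟨p₂, hp₂⟩ := exists_forall_forall_le hP hD fun d => exists_forall_forall_le hP hD
    fun d' => exists_forall_forall_le hP hD fun d'' => exists_forall_forall_le hP (hD' d d')
      fun α => exists_forall_forall_le hP (hD' d' d'') fun β =>
      H (a.hom α ≫ b.hom β) (a.hom (α ≫ β) ≫ (V d'').map (homOfLE b.le)) (by
        rw [assoc, assoc, hj, a.hom_comp, b.hom_comp, z.map_comp, reassoc_of% a.hom_comp α])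
  obtain ⟨q, hq⟩ := hP (hasCardinalLT_of_finite (ULift.{v} (Fin 3)) κ hκ) (fun i =>
    match i with
    | ⟨0⟩ => b.next
    | ⟨1⟩ => p₁
    | ⟨2⟩ => p₂)
  have hb : b.next ≤ q := hq ⟨0⟩
  have h₁ : p₁ ≤ q := hq ⟨1⟩
  have h₂ : p₂ ≤ q := hq ⟨2⟩
  refine ⟨⟨q, b.le.trans hb, fun {d d'} α => b.hom α ≫ (V d').map (homOfLE hb), fun α => ?_⟩,
    fun {d d'} α => ?_, fun {d d' d''} α β => ?_⟩
  · rw [assoc, hj, b.hom_comp]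
  · have := hp₁ q h₁ d d' α hb
    rwa [assoc, assoc, map_homOfLE_comp] at this
  · have := hp₂ q h₂ d d' d'' α β hb
    rwa [assoc, assoc, map_homOfLE_comp] at this

/-- A semifunctor on a directed colimit restricts to a semifunctor on a term of the diagram, if
its terms are suitably presentable. -/
theorem exists_semifunctor {κ : Cardinal.{v}} (hκ : Cardinal.aleph0 ≤ κ)
    (hP : ∀ {ι : Type v}, HasCardinalLT ι κ →
    ∀ s : ι → P, ∃ p, ∀ i, s i ≤ p) (hD : HasCardinalLT D κ)
    (hD' : ∀ d d' : D, HasCardinalLT (d ⟶ d') κ) {V : D → P ⥤ K} {M : D → K}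
    {j : ∀ d p, (V d).obj p ⟶ M d} (hj : ∀ d p p' (h : p ≤ p'), (V d).map (homOfLE h) ≫ j d p' =
      j d p)
    (hV : ∀ d d' p (f : (V d).obj p ⟶ M d'), ∃ p' f', f' ≫ j d' p' = f)
    (hV' : ∀ d d' p p' (f f' : (V d).obj p ⟶ (V d').obj p'), f ≫ j d' p' = f' ≫ j d' p' →
      ∃ p'', ∃ h : p' ≤ p'', f ≫ (V d').map (homOfLE h) = f' ≫ (V d').map (homOfLE h))
    (hω : ∀ s : ℕ → P, Monotone s → ∃ q, ∃ hq : ∀ n, s n ≤ q, ∀ d W,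
      (∀ f : ∀ n, (V d).obj (s n) ⟶ W,
        (∀ n (h : s n ≤ s (n + 1)), (V d).map (homOfLE h) ≫ f (n + 1) = f n) →
        ∃ l, ∀ n, (V d).map (homOfLE (hq n)) ≫ l = f n) ∧
      ∀ l l' : (V d).obj q ⟶ W, (∀ n, (V d).map (homOfLE (hq n)) ≫ l =
        (V d).map (homOfLE (hq n)) ≫ l') → l = l')
    (z : Semifunctor M) (p : P) :
    ∃ q, p ≤ q ∧ ∃ w : Semifunctor fun d => (V d).obj q,
      ∀ {d d' : D} (α : d ⟶ d'), w.map α ≫ j d' q = j d q ≫ z.map α := by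
  obtain ⟨a₀⟩ := Approximation.exists hκ hP hD hD' hj hV z p
  choose nxt h₁ h₂ using
    fun σ : Σ p, Approximation V j z p => Approximation.exists_next hκ hP hD hD' hj hV hV' σ.2
  let σ (n : ℕ) : Σ p, Approximation V j z p := Nat.rec ⟨p, a₀⟩ (fun _ τ => ⟨_, nxt τ⟩) n
  let s (n : ℕ) : P := (σ n).1
  let a (n : ℕ) {d d' : D} (α : d ⟶ d') : (V d).obj (s n) ⟶ (V d').obj (s (n + 1)) :=
    (σ n).2.hom α
  have hs (n) : s n ≤ s (n + 1) := (σ n).2.le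
  have ha (n) {d d' : D} (α : d ⟶ d') : a n α ≫ j d' (s (n + 1)) = j d (s n) ≫ z.map α :=
    (σ n).2.hom_comp α
  have h₁ (n) {d d' : D} (α : d ⟶ d') : (V d).map (homOfLE (hs n)) ≫ a (n + 1) α =
      a n α ≫ (V d').map (homOfLE (hs (n + 1))) := h₁ (σ n) α
  have h₂ (n) {d d' d'' : D} (α : d ⟶ d') (β : d' ⟶ d'') : a n α ≫ a (n + 1) β =
      a n (α ≫ β) ≫ (V d'').map (homOfLE (hs (n + 1))) := h₂ (σ n) α β
  have hs₀ : s 0 = p := rfl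
  clear_value a s
  obtain ⟨q, hq, H⟩ := hω s (monotone_nat_of_le_succ hs)
  have h₃ (d d' : D) (α : d ⟶ d') := (H d ((V d').obj q)).1
    (fun n => a n α ≫ (V d').map (homOfLE (hq (n + 1)))) (fun n h => by
      rw [reassoc_of% h₁ n α, map_homOfLE_comp])
  choose w hw using h₃
  refine ⟨q, hs₀ ▸ hq 0, ⟨fun α => w _ _ α, fun {d d' d''} α β => ?_⟩, fun {d d'} α => ?_⟩
  · refine (H _ _).2 _ _ fun n => ?_
    rw [hw, reassoc_of% hw d d' α n, hw, reassoc_of% h₂ n α β, map_homOfLE_comp]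
  · refine (H _ _).2 _ _ fun n => ?_
    rw [reassoc_of% hw d d' α n, hj, ha, ← assoc, hj]

end Semifunctor

section Restrict

variable {Λ : Type v} [PartialOrder Λ] {P : Type v} [Preorder P] (ρ : P →o LowerSet Λ)

/-- The intersections of a lower set with a monotone family of lower sets. -/
abbrev restrictBy (Q : LowerSet Λ) : P ⥤ LowerSet Λ :=
  Monotone.functor (f := fun p => ρ p ⊓ Q) fun _ _ h => inf_le_inf_right _ (ρ.monotone h)

/-- The cocone expressing the value of `T` on `Q` as a colimit. -/
abbrev restrictByCocone (T : LowerSet Λ ⥤ K) (Q : LowerSet Λ) : Cocone (restrictBy ρ Q ⋙ T) where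
  pt := T.obj Q
  ι :=
    { app := fun _ => T.map (homOfLE inf_le_right)
      naturality := fun _ _ _ => (map_homOfLE_comp T _ _).trans (comp_id _).symm }

lemma IsGluing.isColimit_restrictByCocone [IsDirectedOrder P] {T : LowerSet Λ ⥤ K}
    (hT : IsGluing T) (hρ : ∀ c, ∃ p, c ∈ ρ p) (Q : LowerSet Λ) :
    Nonempty (IsColimit (restrictByCocone ρ T Q)) :=
  ⟨hT.isColimitOfDirected (restrictBy ρ Q) (S' := Q) (fun _ => inf_le_right)
    (fun q hq => (hρ q).imp fun _ hp => ⟨hp, hq⟩) _ (Iso.refl _) fun _ => comp_id _⟩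

lemma isDirectedOrder_of_isCardinalFiltered (P : Type v) [Preorder P] (κ : Cardinal.{v})
    [Fact κ.IsRegular] [IsCardinalFiltered P κ] : IsDirectedOrder P :=
  have := isFiltered_of_isCardinalFiltered P κ
  ⟨fun p q => ⟨IsFiltered.max p q, leOfHom (IsFiltered.leftToMax p q),
    leOfHom (IsFiltered.rightToMax p q)⟩⟩

namespace IsGluing

variable {ρ} {T : LowerSet Λ ⥤ K}

section

variable {κ : Cardinal.{v}} [Fact κ.IsRegular] [IsCardinalFiltered P κ]

lemma exists_factorization (hT : IsGluing T) (hρ : ∀ c, ∃ p, c ∈ ρ p) {Q : LowerSet Λ}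
    {X : K} [CategoryTheory.IsCardinalPresentable X κ]
    (f : X ⟶ T.obj Q) :
    ∃ (p : P) (f' : X ⟶ T.obj (ρ p ⊓ Q)), f' ≫ T.map (homOfLE inf_le_right) = f := by
  have := isDirectedOrder_of_isCardinalFiltered P κ
  obtain ⟨h⟩ := hT.isColimit_restrictByCocone ρ hρ Q
  exact CategoryTheory.IsCardinalPresentable.exists_hom_of_isColimit κ h f

lemma exists_map_eq (hT : IsGluing T) (hρ : ∀ c, ∃ p, c ∈ ρ p) {Q : LowerSet Λ}
    {X : K} [CategoryTheory.IsCardinalPresentable X κ] {p : P}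
    (f f' : X ⟶ T.obj (ρ p ⊓ Q))
    (h : f ≫ T.map (homOfLE inf_le_right) = f' ≫ T.map (homOfLE inf_le_right)) :
    ∃ (p' : P) (hp : p ≤ p'),
      f ≫ T.map (homOfLE (inf_le_inf_right Q (ρ.monotone hp))) =
        f' ≫ T.map (homOfLE (inf_le_inf_right Q (ρ.monotone hp))) := by
  have := isDirectedOrder_of_isCardinalFiltered P κ
  obtain ⟨h'⟩ := hT.isColimit_restrictByCocone ρ hρ Q
  obtain ⟨p', u, hu⟩ :=
    CategoryTheory.IsCardinalPresentable.exists_eq_of_isColimit' κ h' f f' h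
  exact ⟨p', leOfHom u, hu⟩

end

lemma exists_desc_of_nat (hT : IsGluing T) {s : ℕ → P} (hs : Monotone s) {q : P} (hq : ∀ n, s n ≤ q)
    (h : ∀ c ∈ ρ q, ∃ n, c ∈ ρ (s n)) {Q : LowerSet Λ} {W : K}
    (f : ∀ n, T.obj (ρ (s n) ⊓ Q) ⟶ W)
    (hf : ∀ n, T.map (homOfLE (inf_le_inf_right Q (ρ.monotone (hs n.le_succ)))) ≫ f (n + 1) =
      f n) :
    ∃ l, ∀ n, T.map (homOfLE (inf_le_inf_right Q (ρ.monotone (hq n)))) ≫ l = f n := by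
  have hf' (n m : ℕ) (hnm : n ≤ m) :
      T.map (homOfLE (inf_le_inf_right Q (ρ.monotone (hs hnm)))) ≫ f m = f n := by
    induction m, hnm using Nat.le_induction with
    | base => rw [map_homOfLE_refl, id_comp]
    | succ m hm ih => rw [← ih, ← hf m, map_homOfLE_comp_assoc]
  refine hT.exists_desc_of_cover (fun n => ρ (s n) ⊓ Q) _ (fun c hc => ?_) f
    fun n m c hn hm => ?_
  · obtain ⟨n, hn⟩ := h c hc.1
    exact ⟨n, hn, hc.2⟩
  · obtain hnm | hnm := le_total n m
    · rw [← hf' n m hnm, map_homOfLE_comp_assoc]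
    · rw [← hf' m n hnm, map_homOfLE_comp_assoc]

lemma hom_ext_of_nat (hT : IsGluing T) {s : ℕ → P} {q : P} (hq : ∀ n, s n ≤ q)
    (h : ∀ c ∈ ρ q, ∃ n, c ∈ ρ (s n)) {Q : LowerSet Λ} {W : K} (l l' : T.obj (ρ q ⊓ Q) ⟶ W)
    (hl : ∀ n, T.map (homOfLE (inf_le_inf_right Q (ρ.monotone (hq n)))) ≫ l =
      T.map (homOfLE (inf_le_inf_right Q (ρ.monotone (hq n)))) ≫ l') : l = l' := by
  refine hT.hom_ext_of_cover (fun n => ρ (s n) ⊓ Q) _ (fun c hc => ?_) l l' hl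
  obtain ⟨n, hn⟩ := h c hc.1
  exact ⟨n, hn, hc.2⟩

end IsGluing

end Restrict

section

variable {Λ : Type v} [PartialOrder Λ] (T : LowerSet Λ ⥤ K)

/-- The morphism `T.obj S ⟶ T.obj S'` as an arrow. -/
abbrev arrowOfLE {S S' : LowerSet Λ} (h : S ≤ S') : Arrow K := Arrow.mk (T.map (homOfLE h))

/-- The functoriality of `arrowOfLE`. -/
abbrev arrowOfLEMap {S S' R R' : LowerSet Λ} (h : S ≤ S') (h' : R ≤ R') (hS : S ≤ R)
    (hS' : S' ≤ R') : arrowOfLE T h ⟶ arrowOfLE T h' :=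
  Arrow.homMk (T.map (homOfLE hS)) (T.map (homOfLE hS')) (by
    dsimp
    rw [map_homOfLE_comp, map_homOfLE_comp])

end

section

variable {D : Type v} (Λ : D → Type v) [∀ d, PartialOrder (Λ d)] (κ : Cardinal.{v})

/-- Families of `κ`-small lower sets. -/
abbrev SmallLowerSets : Type v := {R : ∀ d, LowerSet (Λ d) // ∀ d, HasCardinalLT (R d) κ}

variable {Λ κ}

/-- The components of a family of lower sets. -/
abbrev SmallLowerSets.proj (d : D) : SmallLowerSets Λ κ →o LowerSet (Λ d) :=
  ⟨fun R => R.1 d, fun _ _ h => h d⟩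

lemma SmallLowerSets.exists_ge [Fact κ.IsRegular] {ι : Type v} (hι : HasCardinalLT ι κ)
    (s : ι → SmallLowerSets Λ κ) :
    ∃ p, (∀ i, s i ≤ p) ∧ ∀ d, ∀ c ∈ p.1 d, ∃ i, c ∈ (s i).1 d := by
  refine ⟨⟨fun d => ⨆ i, (s i).1 d, fun d => ?_⟩, fun i d => ?_, fun d c hc => ?_⟩
  · change HasCardinalLT ((⨆ i, (s i).1 d : LowerSet (Λ d)) : Set (Λ d)) κ
    rw [LowerSet.coe_iSup]
    exact hasCardinalLT_iUnion _ hι fun i => (s i).2 d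
  · exact le_iSup (fun i => (s i).1 d) i
  · exact LowerSet.mem_iSup_iff.1 hc

instance [Fact κ.IsRegular] : IsCardinalFiltered (SmallLowerSets Λ κ) κ :=
  isCardinalFiltered_preorder _ _ fun _ s hs =>
    (SmallLowerSets.exists_ge ((hasCardinalLT_iff_cardinal_mk_lt _ _).2 hs) s).imp fun _ h => h.1

lemma SmallLowerSets.exists_ge₂ [Fact κ.IsRegular] (p p' : SmallLowerSets Λ κ) :
    ∃ q, p ≤ q ∧ p' ≤ q := by
  obtain ⟨q, hq, -⟩ := SmallLowerSets.exists_ge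
    (hasCardinalLT_of_finite (ULift.{v} Bool) κ (Fact.out : κ.IsRegular).aleph0_le)
    fun b => if b.down then p else p'
  exact ⟨q, hq ⟨true⟩, hq ⟨false⟩⟩

lemma SmallLowerSets.exists_mem [Fact κ.IsRegular] (d : D) (S : LowerSet (Λ d))
    (hS : HasCardinalLT S κ) : ∃ p : SmallLowerSets Λ κ, S ≤ p.1 d := by
  classical
  refine ⟨⟨Function.update (fun _ => ⊥) d S, fun d' => ?_⟩, by simp⟩
  obtain rfl | h := eq_or_ne d' d
  · simpa using hS
  · rw [Function.update_of_ne h]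
    have : IsEmpty (⊥ : LowerSet (Λ d')) := ⟨fun x => x.2⟩
    exact hasCardinalLT_of_finite _ κ (Fact.out : κ.IsRegular).aleph0_le

lemma hasCardinalLT_of_lowerSet_le {Λ : Type v} [PartialOrder Λ] {S S' : LowerSet Λ}
    (h : HasCardinalLT S' κ) (hS : S ≤ S') : HasCardinalLT S κ :=
  h.of_injective (Set.inclusion hS) (Set.inclusion_injective hS)

end

section

variable {D : Type v} [SmallCategory D] {Λ : D → Type v} [∀ d, PartialOrder (Λ d)]
  {κ : Cardinal.{v}} [Fact κ.IsRegular] {T : ∀ d, LowerSet (Λ d) ⥤ K}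

/-- The restrictions of the morphism `T.obj S ⟶ T.obj S'` to small families of lower sets. -/
abbrev restrictArrow (T : ∀ d, LowerSet (Λ d) ⥤ K) {S S' : ∀ d, LowerSet (Λ d)} (hS : S ≤ S')
    (κ : Cardinal.{v}) (d : D) :
    SmallLowerSets Λ κ ⥤ Arrow K where
  obj R := arrowOfLE (T d) (inf_le_inf_left (R.1 d) (hS d))
  map {R R'} h := arrowOfLEMap (T d) _ _ (inf_le_inf_right _ (leOfHom h d))
    (inf_le_inf_right _ (leOfHom h d))
  map_id R := by ext <;> exact (T d).map_id _
  map_comp h h' := by ext <;> exact (map_homOfLE_comp _ _ _).symm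

theorem exists_small_semifunctor (hκ : Cardinal.aleph0 < κ) (hD : HasCardinalLT D κ)
    (hD' : ∀ d d' : D, HasCardinalLT (d ⟶ d') κ) (hT : ∀ d, IsGluing (T d))
    (hc : ∀ d c, HasCardinalLT (LowerSet.Iic (c : Λ d)) κ)
    (hp : ∀ d (S : LowerSet (Λ d)), HasCardinalLT S κ →
      CategoryTheory.IsCardinalPresentable ((T d).obj S) κ)
    {S S' : ∀ d, LowerSet (Λ d)} (hS : S ≤ S')
    (z : Semifunctor fun d => arrowOfLE (T d) (hS d)) (R₀ : SmallLowerSets Λ κ) :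
    ∃ R : SmallLowerSets Λ κ, R₀ ≤ R ∧
      ∃ w : Semifunctor fun d => arrowOfLE (T d) (inf_le_inf_left (R.1 d) (hS d)),
      ∀ {d d' : D} (α : d ⟶ d'), w.map α ≫ arrowOfLEMap (T d') _ (hS d') inf_le_right inf_le_right =
        arrowOfLEMap (T d) _ (hS d) inf_le_right inf_le_right ≫ z.map α := by
  have hρ (d) (c : Λ d) : ∃ p : SmallLowerSets Λ κ, c ∈ SmallLowerSets.proj d p :=
    (SmallLowerSets.exists_mem d (LowerSet.Iic c) (hc d c)).imp fun _ h => h le_rfl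
  have hp' (d) (p : SmallLowerSets Λ κ) (S : LowerSet (Λ d)) :
      CategoryTheory.IsCardinalPresentable ((T d).obj (p.1 d ⊓ S)) κ :=
    hp _ _ (hasCardinalLT_of_lowerSet_le (p.2 d) inf_le_left)
  refine exists_semifunctor (K := Arrow K) hκ.le (fun hι s =>
    (SmallLowerSets.exists_ge hι s).imp fun _ h => h.1) hD hD' (V := restrictArrow T hS κ)
    (M := fun d => arrowOfLE (T d) (hS d))
    (j := fun d R => arrowOfLEMap (T d) _ (hS d) inf_le_right inf_le_right) ?_ ?_ ?_ ?_ z R₀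
  · intro d p p' h
    ext <;> exact map_homOfLE_comp _ _ _
  · intro d d' p f
    have := hp' d p (S d)
    have := hp' d p (S' d)
    obtain ⟨p₁, l, hl⟩ := (hT d').exists_factorization (κ := κ)
      (X := (T d).obj (p.1 d ⊓ S d)) (hρ d') f.left
    obtain ⟨p₂, r, hr⟩ := (hT d').exists_factorization (κ := κ)
      (X := (T d).obj (p.1 d ⊓ S' d)) (hρ d') f.right
    obtain ⟨q, h₁, h₂⟩ := SmallLowerSets.exists_ge₂ p₁ p₂
    obtain ⟨p', h, w⟩ := (hT d').exists_map_eq (κ := κ) (hρ d') (p := q) (Q := S' d')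
      ((l ≫ (T d').map (homOfLE (inf_le_inf_right _ (h₁ d')))) ≫
        (T d').map (homOfLE (inf_le_inf_left _ (hS d'))))
      ((T d).map (homOfLE (inf_le_inf_left _ (hS d))) ≫
        r ≫ (T d').map (homOfLE (inf_le_inf_right _ (h₂ d')))) (by
          have := f.w
          dsimp at this
          simp only [assoc, map_homOfLE_comp]
          rw [hr, ← this, ← hl, assoc, map_homOfLE_comp])
    simp only [assoc, map_homOfLE_comp] at w
    refine ⟨p', Arrow.homMk (l ≫ (T d').map (homOfLE (inf_le_inf_right _ ((h₁.trans h) d'))))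
      (r ≫ (T d').map (homOfLE (inf_le_inf_right _ ((h₂.trans h) d')))) ?_, ?_⟩
    · dsimp
      rw [assoc, map_homOfLE_comp]
      exact w
    · ext
      · exact (assoc _ _ _).trans ((congrArg (l ≫ ·) (map_homOfLE_comp _ _ _)).trans hl)
      · exact (assoc _ _ _).trans ((congrArg (r ≫ ·) (map_homOfLE_comp _ _ _)).trans hr)
  · intro d d' p p' f f' h
    have := hp' d p (S d)
    have := hp' d p (S' d)
    obtain ⟨p₁, h₁, w₁⟩ := (hT d').exists_map_eq (κ := κ)
      (X := (T d).obj (p.1 d ⊓ S d)) (hρ d') (p := p')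
      f.left f'.left
      (congrArg CommaMorphism.left h)
    obtain ⟨p₂, h₂, w₂⟩ := (hT d').exists_map_eq (κ := κ)
      (X := (T d).obj (p.1 d ⊓ S' d)) (hρ d') (p := p')
      f.right f'.right
      (congrArg CommaMorphism.right h)
    obtain ⟨q, hq₁, hq₂⟩ := SmallLowerSets.exists_ge₂ p₁ p₂
    refine ⟨q, h₁.trans hq₁, ?_⟩
    ext
    · have := w₁ =≫ (T d').map (homOfLE (inf_le_inf_right _ (hq₁ d')))
      rwa [assoc, assoc, map_homOfLE_comp] at this
    · have := w₂ =≫ (T d').map (homOfLE (inf_le_inf_right _ (hq₂ d')))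
      rwa [assoc, assoc, map_homOfLE_comp] at this
  · intro s hs
    obtain ⟨q, hq, hq'⟩ := SmallLowerSets.exists_ge (ι := ULift.{v} ℕ)
      ((hasCardinalLT_iff_cardinal_mk_lt _ _).2 (by simpa using hκ)) fun n => s n.down
    have hq'' (d) (c : Λ d) (hc : c ∈ SmallLowerSets.proj d q) :
        ∃ n, c ∈ SmallLowerSets.proj d (s n) := (hq' d c hc).imp' ULift.down fun _ h => h
    refine ⟨q, fun n => hq ⟨n⟩, fun d W => ⟨fun f hf => ?_, fun l l' h => ?_⟩⟩
    · obtain ⟨l, hl⟩ := (hT d).exists_desc_of_nat hs (fun n => hq ⟨n⟩) (hq'' d) (Q := S d)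
        (fun n => (f n).left) fun n => congrArg CommaMorphism.left (hf n (hs n.le_succ))
      obtain ⟨r, hr⟩ := (hT d).exists_desc_of_nat hs (fun n => hq ⟨n⟩) (hq'' d) (Q := S' d)
        (fun n => (f n).right) fun n => congrArg CommaMorphism.right (hf n (hs n.le_succ))
      refine ⟨Arrow.homMk l r ?_, fun n => ?_⟩
      · refine (hT d).hom_ext_of_nat (fun n => hq ⟨n⟩) (hq'' d) (Q := S d) _ _ fun n => ?_
        have := (f n).w
        dsimp at this ⊢
        rw [reassoc_of% hl n, this, map_homOfLE_comp_assoc, ← hr n, map_homOfLE_comp_assoc]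
      · ext
        · exact hl n
        · exact hr n
    · ext
      · exact (hT d).hom_ext_of_nat (fun n => hq ⟨n⟩) (hq'' d) (Q := S d) _ _ fun n =>
          congrArg CommaMorphism.left (h n)
      · exact (hT d).hom_ext_of_nat (fun n => hq ⟨n⟩) (hq'' d) (Q := S' d) _ _ fun n =>
          congrArg CommaMorphism.right (h n)

end

lemma isIdempotentComplete_of_hasCoequalizers [HasCoequalizers K] : IsIdempotentComplete K :=
  (Idempotents.isIdempotentComplete_iff_opposite).1
    ((Idempotents.isIdempotentComplete_iff_hasEqualizer_of_id_and_idempotent _).2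
      fun _ _ _ => inferInstance)

lemma Semifunctor.exists_split {D : Type*} [Category D] [IsIdempotentComplete K] {M : D → K}
    (w : Semifunctor M) :
    ∃ (F : D ⥤ K) (i : ∀ d, F.obj d ⟶ M d) (r : ∀ d, M d ⟶ F.obj d),
      (∀ d, i d ≫ r d = 𝟙 _) ∧ (∀ d, r d ≫ i d = w.map (𝟙 d)) ∧
      (∀ {d d' : D} (α : d ⟶ d'), i d ≫ w.map α = F.map α ≫ i d') ∧
      ∀ {d d' : D} (α : d ⟶ d'), w.map α ≫ r d' = r d ≫ F.map α := by
  choose F i r hi hr using fun d => IsIdempotentComplete.idempotents_split (M d) (w.map (𝟙 d))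
    (by rw [← w.map_comp, comp_id])
  have hr' {d d' : D} (α : d ⟶ d') {Z : K} (h : M d' ⟶ Z) :
      r d ≫ i d ≫ w.map α ≫ h = w.map α ≫ h := by
    rw [reassoc_of% hr d, ← assoc, ← w.map_comp, id_comp]
  have hi' {d d' : D} (α : d ⟶ d') {Z : K} (h : M d' ⟶ Z) :
      w.map α ≫ r d' ≫ i d' ≫ h = w.map α ≫ h := by
    rw [reassoc_of% hr d', ← assoc, ← w.map_comp, comp_id]
  refine ⟨⟨F, fun {d d'} α => i d ≫ w.map α ≫ r d', fun d => ?_, fun {d d' d''} α β => ?_⟩,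
    i, r, hi, hr, fun {d d'} α => ?_, fun {d d'} α => ?_⟩
  · rw [← hr d, assoc, reassoc_of% hi d, hi]
  · simp only [assoc, hi', w.map_comp]
  · have := hi' α (𝟙 _)
    simp only [comp_id] at this
    simp only [assoc, this]
  · exact (hr' α _).symm

section

variable {D : Type v} [SmallCategory D] {Λ : D → Type v} [∀ d, PartialOrder (Λ d)]
  (T : ∀ d, LowerSet (Λ d) ⥤ K) {E B : D ⥤ K} (g : E ⟶ B)
  (z₁ : Semifunctor fun d => (T d).obj ⊤) (b : ∀ d, (T d).obj ⊤ ⟶ B.obj d)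

/-- A lift of `b` along `g`, defined on the objects `(T d).obj (S d)`. -/
structure PartialLift (S : ∀ d, LowerSet (Λ d)) where
  z : Semifunctor fun d => (T d).obj (S d)
  h : ∀ d, (T d).obj (S d) ⟶ E.obj d
  z_top : ∀ {d d' : D} (α : d ⟶ d'), z.map α ≫ (T d').map (homOfLE le_top) =
    (T d).map (homOfLE le_top) ≫ z₁.map α
  z_h : ∀ {d d' : D} (α : d ⟶ d'), z.map α ≫ h d' = h d ≫ E.map α
  h_g : ∀ d, h d ≫ g.app d = (T d).map (homOfLE le_top) ≫ b d

variable {T g z₁ b}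

namespace PartialLift

/-- The relation of extending a partial lift. -/
structure Extends {S S' : ∀ d, LowerSet (Λ d)} (P : PartialLift T g z₁ b S)
    (P' : PartialLift T g z₁ b S') : Prop where
  le : S ≤ S'
  z : ∀ {d d' : D} (α : d ⟶ d'), (T d).map (homOfLE (le d)) ≫ P'.z.map α =
    P.z.map α ≫ (T d').map (homOfLE (le d'))
  h : ∀ d, (T d).map (homOfLE (le d)) ≫ P'.h d = P.h d

lemma Extends.refl {S : ∀ d, LowerSet (Λ d)} (P : PartialLift T g z₁ b S) : P.Extends P where
  le := le_rfl
  z α := by simp only [map_homOfLE_refl, id_comp, comp_id]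
  h d := by simp only [map_homOfLE_refl, id_comp]

lemma Extends.trans {S S' S'' : ∀ d, LowerSet (Λ d)} {P : PartialLift T g z₁ b S}
    {P' : PartialLift T g z₁ b S'} {P'' : PartialLift T g z₁ b S''} (h : P.Extends P')
    (h' : P'.Extends P'') : P.Extends P'' where
  le := h.le.trans h'.le
  z {d d'} α := by
    rw [← map_homOfLE_comp (T d) (h.le d) (h'.le d), assoc, h'.z, reassoc_of% h.z α,
      map_homOfLE_comp]
  h d := by
    rw [← map_homOfLE_comp (T d) (h.le d) (h'.le d), assoc, h'.h, h.h]

theorem exists_glue (hT : ∀ d, IsGluing (T d)) {ι : Type*} {S : ι → ∀ d, LowerSet (Λ d)}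
    (P : ∀ i, PartialLift T g z₁ b (S i)) {Q : ∀ d, LowerSet (Λ d)} (hS : ∀ i, S i ≤ Q)
    (hS' : ∀ d, ∀ c ∈ Q d, ∃ i, c ∈ S i d)
    (hz : ∀ i j {d d' : D} (α : d ⟶ d') c (hi : LowerSet.Iic c ≤ S i d)
      (hj : LowerSet.Iic c ≤ S j d),
      (T d).map (homOfLE hi) ≫ (P i).z.map α ≫ (T d').map (homOfLE (hS i d')) =
        (T d).map (homOfLE hj) ≫ (P j).z.map α ≫ (T d').map (homOfLE (hS j d')))
    (hh : ∀ i j d c (hi : LowerSet.Iic c ≤ S i d) (hj : LowerSet.Iic c ≤ S j d),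
      (T d).map (homOfLE hi) ≫ (P i).h d = (T d).map (homOfLE hj) ≫ (P j).h d) :
    ∃ P' : PartialLift T g z₁ b Q, ∀ i, (P i).Extends P' := by
  choose z hz using fun (d d' : D) (α : d ⟶ d') => (hT d).exists_desc_of_cover (fun i => S i d)
    (fun i => hS i d) (hS' d) (fun i => (P i).z.map α ≫ (T d').map (homOfLE (hS i d')))
    (fun i j c hi hj => hz i j α c (LowerSet.Iic_le.2 hi) (LowerSet.Iic_le.2 hj))
  choose h hh using fun d => (hT d).exists_desc_of_cover (fun i => S i d)
    (fun i => hS i d) (hS' d) (fun i => (P i).h d)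
    (fun i j c hi hj => hh i j d c (LowerSet.Iic_le.2 hi) (LowerSet.Iic_le.2 hj))
  refine ⟨⟨⟨fun α => z _ _ α, fun {d d' d''} α β => ?_⟩, h, fun {d d'} α => ?_,
    fun {d d'} α => ?_, fun d => ?_⟩, fun i => ⟨hS i, fun α => hz _ _ α i, fun d => hh d i⟩⟩
  all_goals
    refine (hT d).hom_ext_of_cover (fun i => S i d) (fun i => hS i d) (hS' d) _ _ fun i => ?_
  · rw [hz, reassoc_of% hz d d' α i, hz, (P i).z.map_comp, assoc]
  · rw [reassoc_of% hz d d' α i, map_homOfLE_comp, map_homOfLE_comp_assoc, (P i).z_top]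
  · rw [reassoc_of% hz d d' α i, reassoc_of% hh d i, hh, (P i).z_h]
  · rw [reassoc_of% hh d i, (P i).h_g, map_homOfLE_comp_assoc]

theorem exists_maximal (hT : ∀ d, IsGluing (T d)) {S : ∀ d, LowerSet (Λ d)}
    (P : PartialLift T g z₁ b S) :
    ∃ (S' : ∀ d, LowerSet (Λ d)) (P' : PartialLift T g z₁ b S'), P.Extends P' ∧
      ∀ (S'' : ∀ d, LowerSet (Λ d)) (P'' : PartialLift T g z₁ b S''), P'.Extends P'' →
        S'' ≤ S' := by
  let α := {σ : Σ S, PartialLift T g z₁ b S // P.Extends σ.2}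
  have : Std.Refl fun σ τ : α => σ.1.2.Extends τ.1.2 := ⟨fun σ => .refl σ.1.2⟩
  have : Nonempty α := ⟨⟨⟨S, P⟩, .refl P⟩⟩
  obtain ⟨m, hm⟩ := exists_maximal_of_nonempty_chains_bounded
    (r := fun σ τ : α => σ.1.2.Extends τ.1.2) (fun c hc hc' => by
      obtain ⟨P', hP'⟩ := exists_glue hT (fun σ : c => σ.1.1.2)
        (Q := fun d => ⨆ σ : c, σ.1.1.1 d) (fun σ d => le_iSup (fun σ : c => σ.1.1.1 d) σ)
        (fun d c hc => LowerSet.mem_iSup_iff.1 hc)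
        (fun σ τ d d' α x hσ hτ => by
          obtain h | h := hc.total σ.2 τ.2
          · rw [← map_homOfLE_comp (T d') (h.le d') (le_iSup (fun σ : c => σ.1.1.1 d') τ),
              ← reassoc_of% h.z α, map_homOfLE_comp_assoc]
          · rw [← map_homOfLE_comp (T d') (h.le d') (le_iSup (fun σ : c => σ.1.1.1 d') σ),
              ← reassoc_of% h.z α, map_homOfLE_comp_assoc])
        (fun σ τ d c hσ hτ => by
          obtain h | h := hc.total σ.2 τ.2
          · rw [← h.h, map_homOfLE_comp_assoc]
          · rw [← h.h, map_homOfLE_comp_assoc])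
      obtain ⟨σ, hσ⟩ := hc'
      exact ⟨⟨⟨_, P'⟩, σ.2.trans (hP' ⟨σ, hσ⟩)⟩, fun σ hσ => hP' ⟨σ, hσ⟩⟩)
    (fun h h' => h.trans h')
  exact ⟨m.1.1, m.1.2, m.2, fun S'' P'' h => (hm ⟨⟨S'', P''⟩, m.2.trans h⟩ h).le⟩

end PartialLift

end

section

variable {D : Type v} [SmallCategory D] {Λ : D → Type v} [∀ d, PartialOrder (Λ d)]
  {T : ∀ d, LowerSet (Λ d) ⥤ K}

theorem exists_small_functor {κ : Cardinal.{v}} [Fact κ.IsRegular] [HasColimitsOfSize.{v, v} K]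
    (hκ : Cardinal.aleph0 < κ) (hD : HasCardinalLT D κ)
    (hD' : ∀ d d' : D, HasCardinalLT (d ⟶ d') κ) (hT : ∀ d, IsGluing (T d))
    (hc : ∀ d c, HasCardinalLT (LowerSet.Iic (c : Λ d)) κ)
    (hp : ∀ d (S : LowerSet (Λ d)), HasCardinalLT S κ →
      CategoryTheory.IsCardinalPresentable ((T d).obj S) κ)
    {S S' : ∀ d, LowerSet (Λ d)} (hS : S ≤ S') (z : Semifunctor fun d => (T d).obj (S d))
    (z' : Semifunctor fun d => (T d).obj (S' d))
    (hz : ∀ {d d' : D} (α : d ⟶ d'), z.map α ≫ (T d').map (homOfLE (hS d')) =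
      (T d).map (homOfLE (hS d)) ≫ z'.map α) (R₀ : SmallLowerSets Λ κ) :
    ∃ R : SmallLowerSets Λ κ, R₀ ≤ R ∧
      ∃ (w : Semifunctor fun d => (T d).obj (R.1 d ⊓ S d))
        (w' : Semifunctor fun d => (T d).obj (R.1 d ⊓ S' d)) (F G : D ⥤ K) (η : F ⟶ G)
        (i : ∀ d, F.obj d ⟶ (T d).obj (R.1 d ⊓ S d)) (r : ∀ d, (T d).obj (R.1 d ⊓ S d) ⟶ F.obj d)
        (i' : ∀ d, G.obj d ⟶ (T d).obj (R.1 d ⊓ S' d))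
        (r' : ∀ d, (T d).obj (R.1 d ⊓ S' d) ⟶ G.obj d),
        (∀ {d d' : D} (α : d ⟶ d'), w.map α ≫ (T d').map (homOfLE inf_le_right) =
          (T d).map (homOfLE inf_le_right) ≫ z.map α) ∧
        (∀ {d d' : D} (α : d ⟶ d'), w'.map α ≫ (T d').map (homOfLE inf_le_right) =
          (T d).map (homOfLE inf_le_right) ≫ z'.map α) ∧
        (∀ {d d' : D} (α : d ⟶ d'),
          w.map α ≫ (T d').map (homOfLE (inf_le_inf_left (R.1 d') (hS d'))) =
          (T d).map (homOfLE (inf_le_inf_left (R.1 d) (hS d))) ≫ w'.map α) ∧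
        (∀ {d d' : D} (α : d ⟶ d'), i d ≫ w.map α = F.map α ≫ i d') ∧
        (∀ {d d' : D} (α : d ⟶ d'), i' d ≫ w'.map α = G.map α ≫ i' d') ∧
        (∀ {d d' : D} (α : d ⟶ d'), w'.map α ≫ r' d' = r' d ≫ G.map α) ∧
        (∀ d, i d ≫ r d = 𝟙 _) ∧ (∀ d, i' d ≫ r' d = 𝟙 _) ∧
        (∀ d, r d ≫ i d = w.map (𝟙 d)) ∧ (∀ d, r' d ≫ i' d = w'.map (𝟙 d)) ∧
        (∀ d, i d ≫ (T d).map (homOfLE (inf_le_inf_left (R.1 d) (hS d))) = η.app d ≫ i' d) ∧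
        (∀ d, r d ≫ η.app d = (T d).map (homOfLE (inf_le_inf_left (R.1 d) (hS d))) ≫ r' d) := by
  obtain ⟨R, hR, w, hw⟩ := exists_small_semifunctor hκ hD hD' hT hc hp hS
    ⟨fun {d d'} α => Arrow.homMk (z.map α) (z'.map α) (hz α), fun α β => by
      ext
      · exact z.map_comp α β
      · exact z'.map_comp α β⟩ R₀
  have : IsIdempotentComplete (Arrow K) := isIdempotentComplete_of_hasCoequalizers
  obtain ⟨Y, i, r, hir, hri, hi, hr⟩ := w.exists_split
  exact ⟨R, hR,
    ⟨fun α => (w.map α).left, fun α β => congrArg CommaMorphism.left (w.map_comp α β)⟩,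
    ⟨fun α => (w.map α).right, fun α β => congrArg CommaMorphism.right (w.map_comp α β)⟩,
    Y ⋙ Arrow.leftFunc, Y ⋙ Arrow.rightFunc, Functor.whiskerLeft Y Arrow.leftToRight,
    fun d => (i d).left, fun d => (r d).left, fun d => (i d).right, fun d => (r d).right,
    fun α => congrArg CommaMorphism.left (hw α), fun α => congrArg CommaMorphism.right (hw α),
    fun α => (w.map α).w, fun α => congrArg CommaMorphism.left (hi α),
    fun α => congrArg CommaMorphism.right (hi α), fun α => congrArg CommaMorphism.right (hr α),
    fun d => congrArg CommaMorphism.left (hir d), fun d => congrArg CommaMorphism.right (hir d),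
    fun d => congrArg CommaMorphism.left (hri d), fun d => congrArg CommaMorphism.right (hri d),
    fun d => (i d).w, fun d => (r d).w⟩

variable {E B : D ⥤ K} {g : E ⟶ B}
  {z₁ : Semifunctor fun d => (T d).obj ⊤} {b : ∀ d, (T d).obj ⊤ ⟶ B.obj d}

namespace PartialLift

theorem exists_extends {κ : Cardinal.{v}} [Fact κ.IsRegular] [HasColimitsOfSize.{v, v} K]
    (hκ : Cardinal.aleph0 < κ) (hD : HasCardinalLT D κ)
    (hD' : ∀ d d' : D, HasCardinalLT (d ⟶ d') κ) (hT : ∀ d, IsGluing (T d))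
    (hc : ∀ d c, HasCardinalLT (LowerSet.Iic (c : Λ d)) κ)
    (hp : ∀ d (S : LowerSet (Λ d)), HasCardinalLT S κ →
      CategoryTheory.IsCardinalPresentable ((T d).obj S) κ)
    {C : MorphismProperty K} (hC : retracts C ≤ C) {A : ∀ d, LowerSet (Λ d)}
    (hCT : ∀ d (S S' : LowerSet (Λ d)) (h : S ≤ S'), S' ⊓ A d ≤ S → C ((T d).map (homOfLE h)))
    (hg : ∀ {F G : D ⥤ K} (η : F ⟶ G), (∀ d, C (η.app d)) →
      (∀ d, CategoryTheory.IsCardinalPresentable (F.obj d) κ) →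
      (∀ d, CategoryTheory.IsCardinalPresentable (G.obj d) κ) → HasLiftingProperty η g)
    (hb : ∀ {d d' : D} (α : d ⟶ d'), z₁.map α ≫ b d' = b d ≫ B.map α)
    {S : ∀ d, LowerSet (Λ d)} (hA : A ≤ S) (P : PartialLift T g z₁ b S)
    (R₀ : SmallLowerSets Λ κ) :
    ∃ (S' : ∀ d, LowerSet (Λ d)) (P' : PartialLift T g z₁ b S'), P.Extends P' ∧ R₀.1 ≤ S' := by
  obtain ⟨R, hR, w, w', F, G, η, i, r, i', r', hw, hw₁, hww, hi, hi', hr', hir, hir', hri, hri',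
    hiη, hrη⟩ := exists_small_functor hκ hD hD' hT hc hp (S := S) (S' := fun _ => ⊤)
      (fun _ => le_top) P.z z₁ P.z_top R₀
  have hpR (d) (S : LowerSet (Λ d)) :
      CategoryTheory.IsCardinalPresentable ((T d).obj (R.1 d ⊓ S)) κ :=
    hp _ _ (hasCardinalLT_of_lowerSet_le (R.2 d) inf_le_left)
  have : HasLiftingProperty η g := hg η
    (fun d => hC _ ⟨_, _, _, hCT d (R.1 d ⊓ S d) (R.1 d ⊓ ⊤) (inf_le_inf_left _ le_top)
      (le_inf (inf_le_left.trans inf_le_left) (inf_le_right.trans (hA d))),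
      i d, i' d, r d, r' d, hiη d, hrη d, hir d, hir' d⟩)
    (fun d => (show Retract (F.obj d) _ from ⟨i d, r d, hir d⟩).isCardinalPresentable κ)
    (fun d => (show Retract (G.obj d) _ from ⟨i' d, r' d, hir' d⟩).isCardinalPresentable κ)
  let t : F ⟶ E :=
    { app d := i d ≫ (T d).map (homOfLE inf_le_right) ≫ P.h d
      naturality d d' α := by
        rw [assoc, assoc, ← P.z_h α, ← reassoc_of% hw α, reassoc_of% hi α] }
  let b' : G ⟶ B :=
    { app d := i' d ≫ (T d).map (homOfLE inf_le_right) ≫ b d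
      naturality d d' α := by
        rw [assoc, assoc, ← hb α, ← reassoc_of% hw₁ α, reassoc_of% hi' α] }
  have sq : CommSq t η g b' := ⟨by
    ext d
    dsimp [t, b']
    rw [assoc, assoc, P.h_g, ← reassoc_of% hiη d, map_homOfLE_comp_assoc,
      map_homOfLE_comp_assoc]⟩
  let l := sq.lift
  have hl (d) : η.app d ≫ l.app d = i d ≫ (T d).map (homOfLE inf_le_right) ≫ P.h d :=
    congrArg (fun η => NatTrans.app η d) sq.fac_left
  have hl' (d) : l.app d ≫ g.app d = i' d ≫ (T d).map (homOfLE inf_le_right) ≫ b d :=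
    congrArg (fun η => NatTrans.app η d) sq.fac_right
  let P' : PartialLift T g z₁ b fun d => R.1 d ⊓ ⊤ :=
    { z := w'
      h d := r' d ≫ l.app d
      z_top α := hw₁ α
      z_h {d d'} α := by
        rw [reassoc_of% hr' α, assoc, l.naturality α]
      h_g d := by
        rw [assoc, hl', reassoc_of% hri' d, reassoc_of% hw₁ (𝟙 d), hb, B.map_id, comp_id] }
  have hP' (d) (h : R.1 d ⊓ S d ≤ R.1 d ⊓ ⊤) :
      (T d).map (homOfLE h) ≫ P'.h d = (T d).map (homOfLE inf_le_right) ≫ P.h d := by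
    dsimp [P']
    rw [← reassoc_of% hrη d, hl, reassoc_of% hri d, reassoc_of% hw (𝟙 d), P.z_h, E.map_id,
      comp_id]
  have hz {Q : ∀ d, LowerSet (Λ d)} (hS : S ≤ Q) (hR : (fun d => R.1 d ⊓ ⊤) ≤ Q) {d d' : D}
      (α : d ⟶ d') {X : LowerSet (Λ d)} (h : X ≤ S d) (h' : X ≤ R.1 d ⊓ ⊤) :
      (T d).map (homOfLE h) ≫ P.z.map α ≫ (T d').map (homOfLE (hS d')) =
        (T d).map (homOfLE h') ≫ P'.z.map α ≫ (T d').map (homOfLE (hR d')) := by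
    have hX : X ≤ R.1 d ⊓ S d := le_inf (h'.trans inf_le_left) h
    rw [← map_homOfLE_comp (T d) hX inf_le_right, assoc, ← reassoc_of% hw α, map_homOfLE_comp,
      ← map_homOfLE_comp (T d) hX (inf_le_inf_left _ le_top), assoc, ← reassoc_of% hww α,
      map_homOfLE_comp]
  have hh {d : D} {X : LowerSet (Λ d)} (h : X ≤ S d) (h' : X ≤ R.1 d ⊓ ⊤) :
      (T d).map (homOfLE h) ≫ P.h d = (T d).map (homOfLE h') ≫ P'.h d := by
    have hX : X ≤ R.1 d ⊓ S d := le_inf (h'.trans inf_le_left) h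
    rw [← map_homOfLE_comp (T d) hX inf_le_right, assoc, ← hP' d (inf_le_inf_left _ le_top),
      map_homOfLE_comp_assoc]
  obtain ⟨P'', h⟩ := exists_glue hT (S := fun i : Bool => cond i S fun d => R.1 d ⊓ ⊤)
    (Bool.rec P' P) (Q := S ⊔ fun d => R.1 d ⊓ ⊤) (Bool.rec le_sup_right le_sup_left)
    (fun d c hc => by
      obtain hc | hc := LowerSet.mem_sup_iff.1 hc
      · exact ⟨true, hc⟩
      · exact ⟨false, hc⟩)
    (by
      rintro (_ | _) (_ | _) d d' α c hi hj
      · rfl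
      · exact (hz le_sup_left le_sup_right α hj hi).symm
      · exact hz le_sup_left le_sup_right α hi hj
      · rfl)
    (by
      rintro (_ | _) (_ | _) d c hi hj
      · rfl
      · exact (hh hj hi).symm
      · exact hh hi hj
      · rfl)
  exact ⟨_, P'', h true, fun d => (hR d).trans (by simp)⟩

end PartialLift

end

theorem hasLiftingProperty_of_presentable {D : Type v} [SmallCategory D] {κ : Cardinal.{v}}
    [Fact κ.IsRegular] [IsCardinalLocallyPresentable K κ]
    (hκ : Cardinal.aleph0 < κ) (hD : HasCardinalLT D κ)
    (hD' : ∀ d d' : D, HasCardinalLT (d ⟶ d') κ)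
    {I C : MorphismProperty K} [MorphismProperty.IsSmall.{v} I]
    (hI : ∀ ⦃A B : K⦄ (f : A ⟶ B), I f → CategoryTheory.IsCardinalPresentable A κ ∧
      CategoryTheory.IsCardinalPresentable B κ)
    (hC : IsCellular C) (hC' : retracts C ≤ C) (hIC : I ≤ C) (hCI : C ≤ I.rlp.llp)
    {E B : D ⥤ K} (g : E ⟶ B)
    (hg : ∀ {F G : D ⥤ K} (η : F ⟶ G), (∀ d, C (η.app d)) →
      (∀ d, CategoryTheory.IsCardinalPresentable (F.obj d) κ) →
      (∀ d, CategoryTheory.IsCardinalPresentable (G.obj d) κ) → HasLiftingProperty η g)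
    {X Y : D ⥤ K} (f : X ⟶ Y) (hf : ∀ d, C (f.app d)) : HasLiftingProperty f g where
  sq_hasLift {top bot} sq := by
    choose Λ hΛ hΛ' T A hT e p t htp hef hft using
      fun d => exists_isCellLattice κ hI (f.app d) (hCI _ (hf d))
    have sq' (d) : f.app d ≫ bot.app d = top.app d ≫ g.app d :=
      (congrArg (fun η => NatTrans.app η d) sq.w).symm
    let z₁ : Semifunctor fun d => (T d).obj ⊤ := ⟨fun {d d'} α => p d ≫ Y.map α ≫ t d',
      fun {d d' d''} α β => by simp only [assoc, reassoc_of% htp d', Y.map_comp]⟩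
    let b (d) : (T d).obj ⊤ ⟶ B.obj d := p d ≫ bot.app d
    let P : PartialLift T g z₁ b A :=
      { z := ⟨fun {d d'} α => (e d).inv ≫ X.map α ≫ (e d').hom, fun {d d' d''} α β => by simp⟩
        h d := (e d).inv ≫ top.app d
        z_top {d d'} α := by
          rw [assoc, assoc, ← hft, f.naturality_assoc, Iso.inv_comp_eq, reassoc_of% hef d]
        z_h {d d'} α := by simp
        h_g d := by
          rw [assoc, ← sq', Iso.inv_comp_eq, reassoc_of% hef d] }
    obtain ⟨S, P', hP, hP'⟩ := PartialLift.exists_maximal (fun d => (hT d).gluing) P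
    obtain rfl : S = fun _ => ⊤ := by
      refine le_antisymm (fun d => le_top) fun d => ?_
      intro c _
      obtain ⟨R, hR⟩ := SmallLowerSets.exists_mem (κ := κ) d (LowerSet.Iic c) ((hT d).card c)
      obtain ⟨S', P'', h, h'⟩ := P'.exists_extends hκ hD hD' (fun d => (hT d).gluing)
        (fun d => (hT d).card) (fun d => (hT d).presentable) hC'
        (fun d S S' h h' => hC.transfinite _ (IsTransfiniteCompositionOf.mono
          (Po_le hC hIC) _ ((hT d).isTransfiniteCompositionOf h' h))) hg (fun {d d'} α => by
            dsimp [z₁, b]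
            simp only [assoc, reassoc_of% htp d', bot.naturality]) hP.le R
      exact hP' _ _ h d (h' d (hR le_rfl))
    have hz {d d' : D} (α : d ⟶ d') : P'.z.map α = z₁.map α := by
      have := P'.z_top α
      rwa [map_homOfLE_refl, map_homOfLE_refl, id_comp, comp_id] at this
    have hPg (d) : P'.h d ≫ g.app d = b d := by
      have := P'.h_g d
      rwa [map_homOfLE_refl, id_comp] at this
    exact ⟨⟨⟨{
      app d := t d ≫ P'.h d
      naturality d d' α := by
        rw [assoc, ← P'.z_h α, hz]
        simp only [z₁, assoc, reassoc_of% htp d] }, by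
      ext d
      have := hP.h d
      dsimp [P] at this ⊢
      rw [reassoc_of% hft d, this, Iso.hom_inv_id_assoc], by
      ext d
      dsimp
      rw [assoc, hPg]
      simp only [b, reassoc_of% htp d]⟩⟩⟩

lemma isCardinalDirected_iff {P : Type v} [Preorder P] {κ : Cardinal.{v}} [Fact κ.IsRegular] :
    IsCardinalDirected P κ ↔ IsCardinalFiltered P κ := by
  constructor
  · intro h
    refine isCardinalFiltered_preorder P κ (fun L s hL ↦ ?_)
    obtain ⟨p, hp⟩ := h (Set.range s) (Cardinal.mk_range_le.trans_lt hL)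
    exact ⟨p, fun k ↦ hp _ ⟨k, rfl⟩⟩
  · intro h S hS
    have hS' : HasCardinalLT S κ := by rwa [hasCardinalLT_iff_cardinal_mk_lt]
    exact ⟨IsCardinalFiltered.max (fun s : S ↦ s.1) hS',
      fun s hs ↦ leOfHom (IsCardinalFiltered.toMax (fun s : S ↦ s.1) hS' ⟨s, hs⟩)⟩

lemma isCardinalPresentable_iff {κ : Cardinal.{v}} [Fact κ.IsRegular] {A : K} :
    IsCardinalPresentable κ A ↔ CategoryTheory.IsCardinalPresentable A κ := by
  constructor
  · intro h
    refine ⟨fun J _ _ ↦ ?_⟩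
    obtain ⟨α, _, hα, F, _⟩ := IsCardinalFiltered.exists_cardinal_directed J κ
    obtain ⟨_⟩ := h α inferInstance (isCardinalDirected_iff.2 hα)
    exact Functor.Final.preservesColimitsOfShape_of_final F _
  · intro h P _ hP
    have := isCardinalDirected_iff.1 hP
    exact ⟨preservesColimitsOfShape_of_isCardinalPresentable A κ P⟩

lemma IsLocallyPresentable.isCardinalLocallyPresentable {κ : Cardinal.{v}} [Fact κ.IsRegular]
    (h : IsLocallyPresentable κ K) : IsCardinalLocallyPresentable K κ := by
  obtain ⟨ι, G, hG, hG'⟩ := h.generators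
  have hle : ObjectProperty.ofObj G ≤ isCardinalPresentable K κ := by
    rintro _ ⟨i⟩
    exact isCardinalPresentable_iff.1 (hG i)
  have hgen : (ObjectProperty.ofObj G).isoClosure.IsCardinalFilteredGenerator κ :=
    { le_isCardinalPresentable := by
        simpa only [ObjectProperty.isoClosure_le_iff] using hle
      exists_colimitsOfShape := fun X ↦ by
        obtain ⟨P, _, F, c, hc, hP, ⟨e⟩, hF⟩ := hG' X
        refine ⟨P, inferInstance, isCardinalDirected_iff.1 hP, ⟨?_⟩⟩
        exact
          { diag := F
            ι := (Cocone.extend c e.hom).ι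
            isColimit := hc.extendIso e.hom
            prop_diag_obj := fun p ↦ by
              obtain ⟨i, ⟨e⟩⟩ := hF p
              exact ⟨_, ⟨i⟩, ⟨e⟩⟩ } }
  have := h.hasColimits
  have := hgen.hasCardinalFilteredGenerator
  exact { }

lemma isLocallyPresentable_of_isCardinalLocallyPresentable {κ : Cardinal.{v}}
    [hκ : Fact κ.IsRegular]
    [IsCardinalLocallyPresentable K κ] : IsLocallyPresentable κ K where
  regular := hκ.out
  hasColimits := inferInstance
  generators := by
    obtain ⟨P, _, hP⟩ := HasCardinalFilteredGenerator.exists_small_generator K κ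
    let e := equivShrink.{v} (Subtype P)
    refine ⟨Shrink.{v} (Subtype P), fun i ↦ (e.symm i).1,
      fun i ↦ isCardinalPresentable_iff.2 (hP.le_isCardinalPresentable _ (e.symm i).2),
      fun X ↦ ?_⟩
    obtain ⟨J, _, _, ⟨p⟩⟩ := hP.exists_colimitsOfShape X
    obtain ⟨α, _, hα, F, _⟩ := IsCardinalFiltered.exists_cardinal_directed J κ
    refine ⟨α, inferInstance, F ⋙ p.diag, p.cocone.whisker F,
      (Functor.Final.isColimitWhiskerEquiv F _).symm p.isColimit, isCardinalDirected_iff.2 hα,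
      ⟨Iso.refl _⟩, fun a ↦ ⟨e ⟨_, p.prop_diag_obj (F.obj a)⟩, ⟨eqToIso ?_⟩⟩⟩
    simp

lemma locallyPresentable_iff :
    LocallyPresentable K ↔ CategoryTheory.IsLocallyPresentable.{v} K := by
  constructor
  · rintro ⟨κ, h⟩
    have : Fact κ.IsRegular := ⟨h.regular⟩
    exact ⟨κ, inferInstance, h.isCardinalLocallyPresentable⟩
  · rintro ⟨κ, _, _⟩
    exact ⟨κ, isLocallyPresentable_of_isCardinalLocallyPresentable⟩

lemma isStrongGenerator_freeYoneda {P : ObjectProperty K} (hP : P.IsStrongGenerator)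
    [HasCoproducts.{v} K] (D : Type v) [SmallCategory D] :
    (ObjectProperty.ofObj (fun (T : D × (Subtype P)) ↦
      Presheaf.freeYoneda T.1 T.2.1)).IsStrongGenerator := by
  rw [ObjectProperty.isStrongGenerator_iff] at hP ⊢
  obtain ⟨hP₁, hP₂⟩ := hP
  refine ⟨Presheaf.isSeparating (C := D) (ι := Subtype P) (S := Subtype.val)
    (by simpa using hP₁), fun P₁ P₂ i _ hi ↦ ?_⟩
  rw [NatTrans.isIso_iff_isIso_app]
  rintro ⟨X⟩
  have : Mono (i.app (op X)) := ⟨fun {Z} a b hab ↦ by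
    refine hP₁ _ _ (fun G hG g ↦ ?_)
    apply Presheaf.freeYonedaHomEquiv.symm.injective
    rw [← cancel_mono i]
    simp only [Presheaf.freeYonedaHomEquiv_symm_comp, assoc, hab]⟩
  refine hP₂ _ (fun G hG f ↦ ?_)
  obtain ⟨y, rfl⟩ := Presheaf.freeYonedaHomEquiv.surjective f
  obtain ⟨x, rfl⟩ := hi (Presheaf.freeYoneda X G)
    (ObjectProperty.ofObj_apply (fun (T : D × (Subtype P)) ↦
      Presheaf.freeYoneda T.1 T.2.1) ⟨X, G, hG⟩) y
  exact ⟨Presheaf.freeYonedaHomEquiv x, by simp [Presheaf.freeYonedaHomEquiv_comp]⟩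

lemma isCardinalLocallyPresentable_presheaf (κ : Cardinal.{v}) [Fact κ.IsRegular]
    [IsCardinalLocallyPresentable K κ] (D : Type v) [SmallCategory D] :
    IsCardinalLocallyPresentable (Dᵒᵖ ⥤ K) κ := by
  obtain ⟨P, _, hP₁, hP₂⟩ :=
    (IsCardinalLocallyPresentable.iff_exists_isStrongGenerator K κ).1 inferInstance
  rw [IsCardinalLocallyPresentable.iff_exists_isStrongGenerator]
  refine ⟨_, inferInstance, isStrongGenerator_freeYoneda hP₁ D, ?_⟩
  rintro _ ⟨X, G, hG⟩
  have := hP₂ _ hG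
  rw [CategoryTheory.isCardinalPresentable_iff] at this ⊢
  infer_instance

lemma isCardinalLocallyPresentable_functor (κ : Cardinal.{v}) [Fact κ.IsRegular]
    [IsCardinalLocallyPresentable K κ] (D : Type v) [SmallCategory D] :
    IsCardinalLocallyPresentable (D ⥤ K) κ :=
  have := isCardinalLocallyPresentable_presheaf (K := K) κ Dᵒᵖ
  (opOpEquivalence D).congrLeft.isCardinalLocallyPresentable κ

/-- The natural transformations all of whose components belong to `C`. -/
def pointwise (C : MorphismProperty K) (D : Type v) [SmallCategory D] :
    MorphismProperty (D ⥤ K) :=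
  fun F G η => ∀ d : D, C ((η : NatTrans F G).app d)

lemma IsTransfiniteCompositionOf.map {L : Type u'} [Category.{v} L] (H : K ⥤ L)
    [PreservesColimitsOfSize.{w, w} H] {C : MorphismProperty K} {C' : MorphismProperty L}
    (hC : ∀ ⦃A B : K⦄ (f : A ⟶ B), C f → C' (H.map f)) {A B : K} {f : A ⟶ B}
    (hf : IsTransfiniteCompositionOf.{w} C f) : IsTransfiniteCompositionOf.{w} C' (H.map f) := by
  obtain ⟨J, _, _, _, _, F, c, hc, eA, eB, h₁, h₂, rfl⟩ := hf
  refine ⟨J, _, _, _, ‹_›, F ⋙ H, H.mapCocone c, isColimitOfPreserves H hc, H.mapIso eA,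
    H.mapIso eB, fun j hj => hC _ (h₁ j hj), fun j hj => ?_, by simp⟩
  obtain ⟨h⟩ := h₂ j hj
  exact ⟨isColimitOfPreserves H h⟩

lemma isCellular_pointwise [HasColimitsOfSize.{v, v} K] {C : MorphismProperty K} (hC : IsCellular C)
    (D : Type v) [SmallCategory D] : IsCellular (pointwise C D) where
  isos _ _ _ := hC.isos _ inferInstance
  pushout sq h d := hC.pushout (sq.map ((evaluation D K).obj d)) (h d)
  transfinite _ hf d :=
    hC.transfinite _ (hf.map ((evaluation D K).obj d) fun _ _ _ h => h d)

lemma retracts_pointwise_le {C : MorphismProperty K} (hC : retracts C ≤ C)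
    (D : Type v) [SmallCategory D] : retracts (pointwise C D) ≤ pointwise C D := by
  rintro _ _ f ⟨_, _, g, hg, u, v, r, s, h₁, h₂, h₃, h₄⟩ d
  let ev := (evaluation D K).obj d
  exact hC _ ⟨_, _, g.app d, hg d, u.app d, v.app d, r.app d, s.app d, congrArg ev.map h₁,
    congrArg ev.map h₂, congrArg ev.map h₃, congrArg ev.map h₄⟩

lemma exists_regular_cardinal [CategoryTheory.IsLocallyPresentable.{v} K] {ι : Type v} (X : ι → K)
    {α : Type v} (T : α → Type v) :
    ∃ (κ : Cardinal.{v}) (_ : Fact κ.IsRegular) (_ : IsCardinalLocallyPresentable K κ),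
      Cardinal.aleph0 < κ ∧ (∀ a, HasCardinalLT (T a) κ) ∧
        ∀ i, CategoryTheory.IsCardinalPresentable (X i) κ := by
  obtain ⟨κ₀, _, _⟩ := CategoryTheory.IsLocallyPresentable.exists_cardinal.{v} K
  have h (i : ι) : ∃ (κ : Cardinal.{v}) (_ : Fact κ.IsRegular),
      CategoryTheory.IsCardinalPresentable (X i) κ :=
    Functor.IsAccessible.exists_cardinal
  choose κ₁ h₁ h₁' using h
  obtain ⟨κ, hκ, h⟩ := HasCardinalLT.exists_regular_cardinal_forall.{v}
    (Sum.elim (fun i => (κ₁ i).ord.ToType)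
      (Sum.elim T (fun b : ULift.{v} Bool => if b.down then κ₀.ord.ToType else ULift.{v} ℕ)))
  have : Fact κ.IsRegular := ⟨hκ⟩
  have hκ₀ : κ₀ ≤ κ := by
    have := h (Sum.inr (Sum.inr ⟨true⟩))
    exact le_of_lt (by simpa [hasCardinalLT_iff_cardinal_mk_lt] using this)
  refine ⟨κ, inferInstance, IsCardinalLocallyPresentable.of_le K hκ₀, ?_,
    fun a => h (Sum.inr (Sum.inl a)), fun i => ?_⟩
  · have := h (Sum.inr (Sum.inr ⟨false⟩))
    simpa [hasCardinalLT_iff_cardinal_mk_lt] using this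
  · have hi : κ₁ i ≤ κ := by
      have := h (Sum.inl i)
      exact le_of_lt (by simpa [hasCardinalLT_iff_cardinal_mk_lt] using this)
    have := h₁ i
    have := h₁' i
    exact isCardinalPresentable_of_le (X i) hi

lemma ofHoms_le_ofFamily {ι : Type v} {a b : ι → K} (s : ∀ i, a i ⟶ b i) :
    MorphismProperty.ofHoms s ≤ ofFamily s := by
  rintro _ _ _ ⟨i⟩
  exact ⟨i, ⟨Iso.refl _⟩⟩

lemma ofFamily_le {ι : Type v} {a b : ι → K} {s : ∀ i, a i ⟶ b i} {C : MorphismProperty K}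
    [C.RespectsIso] (h : ∀ i, C (s i)) : ofFamily s ≤ C := by
  rintro _ _ f ⟨i, ⟨e⟩⟩
  exact (C.arrow_mk_iso_iff e).2 (h i)

lemma IsCellular.respectsIso {C : MorphismProperty K} (hC : IsCellular C) : C.RespectsIso :=
  MorphismProperty.RespectsIso.of_respects_arrow_iso _ fun f g e hf =>
    hC.pushout (IsPushout.of_vert_isIso (f := f.hom) (g := e.hom.left) (inl := e.hom.right)
      (inr := g.hom) ⟨e.hom.w.symm⟩) hf

/-- A set of morphisms between presentable objects generates as soon as lifting against it
forces lifting against the whole class. -/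
lemma cofClosure_ofFamily_eq [CategoryTheory.IsLocallyPresentable.{v} K] {C : MorphismProperty K}
    (hC : IsCellular C) (hC' : retracts C ≤ C) {ι : Type v} {a b : ι → K} (s : ∀ i, a i ⟶ b i)
    (hs : ∀ i, C (s i)) (h : C ≤ (MorphismProperty.ofHoms s).rlp.llp) :
    C = cofClosure (ofFamily s) := by
  have := hC.respectsIso
  obtain ⟨κ, _, _, -, -, hκ⟩ := exists_regular_cardinal (Sum.elim a b)
    fun _ : PEmpty.{v + 1} => PUnit.{v + 1}
  refine le_antisymm (h.trans ?_) (cofClosure_le hC hC' (ofFamily_le hs))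
  refine (llp_rlp_le_cofClosure (κ := κ) ?_).trans ?_
  · rintro _ _ _ ⟨i⟩
    exact ⟨hκ (Sum.inl i), hκ (Sum.inr i)⟩
  · rintro _ _ f ⟨_, _, g, hg, hfg⟩
    refine ⟨_, _, g, IsTransfiniteCompositionOf.mono ?_ _ hg, hfg⟩
    rintro _ _ g ⟨_, _, f, _, _, hf, sq⟩
    exact ⟨_, _, f, _, _, ofHoms_le_ofFamily s _ hf, sq⟩

/-- Up to isomorphism, there is only a set of natural transformations in `pointwise C D` between
pointwise `κ`-presentable functors. -/
lemma exists_family_of_presentable (κ : Cardinal.{v}) [Fact κ.IsRegular]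
    [IsCardinalLocallyPresentable K κ] {C : MorphismProperty K} (hC : IsCellular C)
    (D : Type v) [SmallCategory D] :
    ∃ (ι : Type v) (a b : ι → D ⥤ K) (s : ∀ i, a i ⟶ b i), (∀ i, pointwise C D (s i)) ∧
      ∀ {F G : D ⥤ K} (η : F ⟶ G), pointwise C D η →
        (∀ d, CategoryTheory.IsCardinalPresentable (F.obj d) κ) →
        (∀ d, CategoryTheory.IsCardinalPresentable (G.obj d) κ) →
        ofFamily s η := by
  have := hC.respectsIso
  let P := isCardinalPresentable K κ
  let e := equivSmallModel.{v} P.FullSubcategory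
  let i : SmallModel.{v} P.FullSubcategory ⥤ K := e.inverse ⋙ P.ι
  refine ⟨Σ (F : D ⥤ SmallModel.{v} P.FullSubcategory) (G : D ⥤ SmallModel.{v} P.FullSubcategory),
    { η : F ⋙ i ⟶ G ⋙ i // pointwise C D η }, fun t => t.1 ⋙ i, fun t => t.2.1 ⋙ i,
    fun t => t.2.2.1, fun t => t.2.2.2, fun {F G} η hη hF hG => ?_⟩
  let r (F : D ⥤ K) (hF : ∀ d, P (F.obj d)) : (P.lift F hF ⋙ e.functor) ⋙ i ≅ F :=
    Functor.isoWhiskerRight (Functor.isoWhiskerLeft (P.lift F hF) e.unitIso.symm) P.ι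
  refine ⟨⟨P.lift F hF ⋙ e.functor, P.lift G hG ⋙ e.functor, (r F hF).hom ≫ η ≫ (r G hG).inv,
    fun d => ?_⟩, ⟨Arrow.isoMk (r F hF).symm (r G hG).symm ?_⟩⟩
  · change C ((r F hF).hom.app d ≫ η.app d ≫ (r G hG).inv.app d)
    exact MorphismProperty.RespectsIso.precomp _ _ _
      (MorphismProperty.RespectsIso.postcomp _ _ _ (hη d))
  · exact ((r F hF).inv_hom_id_assoc _)

theorem isCofibrantlyGenerated_pointwise {C : MorphismProperty K} (h : IsCombinatorial K C)
    (D : Type v) [SmallCategory D] : IsCofibrantlyGenerated (pointwise C D) := by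
  have hK : CategoryTheory.IsLocallyPresentable.{v} K :=
    locallyPresentable_iff.1 h.locallyPresentable
  obtain ⟨ι, a, b, s, hs⟩ := h.cofibrantlyGenerated
  have hsC : ofFamily s ≤ C := (le_cofClosure _).trans hs.ge
  have hCs : C ≤ (MorphismProperty.ofHoms s).rlp.llp := hs.le.trans
    (cofClosure_le (isCellular_llp _) (retracts_llp_le _)
      (ofFamily_le fun i => MorphismProperty.le_llp_rlp _ _ ⟨i⟩))
  obtain ⟨κ, _, _, hκ, hD, hab⟩ := exists_regular_cardinal (Sum.elim a b)
    (Sum.elim (fun _ : PUnit.{v + 1} => D) fun d : D × D => d.1 ⟶ d.2)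
  have : CategoryTheory.IsLocallyPresentable.{v} (D ⥤ K) :=
    ⟨κ, inferInstance, isCardinalLocallyPresentable_functor κ D⟩
  have hCD := isCellular_pointwise h.cellular D
  obtain ⟨ι', a', b', s', hs', hs''⟩ := exists_family_of_presentable κ h.cellular D
  refine ⟨ι', a', b', s', cofClosure_ofFamily_eq hCD
    (retracts_pointwise_le h.retractClosed D) s' hs' fun X Y f hf E B g hg => ?_⟩
  refine hasLiftingProperty_of_presentable (D := D) hκ (hD (Sum.inl ⟨⟩))
    (fun d d' => hD (Sum.inr (d, d')))
    (I := MorphismProperty.ofHoms s) ?_ h.cellular h.retractClosed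
    ((ofHoms_le_ofFamily s).trans hsC) hCs g (fun η hη hF hG => ?_) f hf
  · rintro _ _ _ ⟨i⟩
    exact ⟨hab (Sum.inl i), hab (Sum.inr i)⟩
  · obtain ⟨i, ⟨e⟩⟩ := hs'' η hη hF hG
    have := hg _ (MorphismProperty.ofHoms_iff _ _ |>.2 ⟨i, rfl⟩)
    exact HasLiftingProperty.of_arrow_iso_left e.symm g

/-- if `K` is combinatorial and `D` is a small category, then the functor
category `D ⥤ K` with the pointwise cofibrations is combinatorial. -/
theorem functor_category_combinatorial {K : Type u} [Category.{v} K]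
    (C : MorphismProperty K) (h : IsCombinatorial K C)
    (D : Type v) [SmallCategory D] :
    IsCombinatorial (D ⥤ K) (fun F G η => ∀ d : D, C ((η : NatTrans F G).app d)) := by
  have := locallyPresentable_iff.1 h.locallyPresentable
  obtain ⟨κ, _, _⟩ := CategoryTheory.IsLocallyPresentable.exists_cardinal.{v} K
  exact
    { locallyPresentable := locallyPresentable_iff.2
        ⟨κ, inferInstance, isCardinalLocallyPresentable_functor κ D⟩
      cellular := isCellular_pointwise h.cellular D
      retractClosed := retracts_pointwise_le h.retractClosed D
      cofibrantlyGenerated := isCofibrantlyGenerated_pointwise h D }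

end CellularPaper
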